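/- arXiv:1805.12595 — 2 statements merged into one kernel-verified Lean document; each statement's English description precedes it below -/
import Mathlib

section
/- For a primitive AVRC that is reversely strongly degraded, if the marginal channel W_{Y_1|X,S} is non-symmetrizable and C_1 > 0, then the deterministic code capacity equals min over pmfs q on S of max over pmfs p on X of I_q(X;Y). -/
open scoped BigOperators ENNReal

noncomputable section

/-- `p` is a probability mass function on a finite type. -/
def IsPMF {α : Type} [Fintype α] (p : α → ℝ) : Prop :=
  (∀ a, 0 ≤ p a) ∧ ∑ a, p a = 1

/-- `W` is a channel: each `W x s` is a pmf on the output alphabet. -/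
def IsChannel {𝒳 𝒮 𝒵 : Type} [Fintype 𝒵] (W : 𝒳 → 𝒮 → 𝒵 → ℝ) : Prop :=
  ∀ x s, IsPMF (W x s)

/-- Shannon entropy (base 2). By the convention `log₂ 0 = 0` in Mathlib, terms with
`p a = 0` contribute `0`. -/
def ent {α : Type} [Fintype α] (p : α → ℝ) : ℝ :=
  -∑ a, p a * Real.logb 2 (p a)

/-- Mutual information of a joint pmf on a product of finite types. -/
def mutInfo {α β : Type} [Fintype α] [Fintype β] (p : α × β → ℝ) : ℝ :=
  ent (fun a => ∑ b, p (a, b)) + ent (fun b => ∑ a, p (a, b)) - ent p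

/-- Conditional mutual information `I(X;Y|U)` of a joint pmf on `U × X × Y`,
via `I(X;Y|U) = H(U,X) + H(U,Y) − H(U,X,Y) − H(U)`. -/
def condMutInfo {υ α β : Type} [Fintype υ] [Fintype α] [Fintype β]
    (p : υ × α × β → ℝ) : ℝ :=
  ent (fun ua : υ × α => ∑ b, p (ua.1, ua.2, b))
    + ent (fun ub : υ × β => ∑ a, p (ub.1, a, ub.2))
    - ent p
    - ent (fun u : υ => ∑ a, ∑ b, p (u, a, b))

section InfoQuantities

variable {𝒳 𝒮 𝒴 𝒴₁ : Type} [Fintype 𝒳] [Fintype 𝒮] [Fintype 𝒴] [Fintype 𝒴₁]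

/-- `I_q(X;Y)` under input pmf `p(x)`, state pmf `q(s)` and channel `W`. -/
def IqXY (W : 𝒳 → 𝒮 → 𝒴 × 𝒴₁ → ℝ) (p : 𝒳 → ℝ) (q : 𝒮 → ℝ) : ℝ :=
  mutInfo (fun xy : 𝒳 × 𝒴 => p xy.1 * ∑ s, q s * ∑ y1, W xy.1 s (xy.2, y1))

/-- `I_q(X;Y,Y₁)`. -/
def IqXYY1 (W : 𝒳 → 𝒮 → 𝒴 × 𝒴₁ → ℝ) (p : 𝒳 → ℝ) (q : 𝒮 → ℝ) : ℝ :=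
  mutInfo (fun xz : 𝒳 × (𝒴 × 𝒴₁) => p xz.1 * ∑ s, q s * W xz.1 s xz.2)

/-- `I_q(U;Y)` under input pmf `p(u,x)` (auxiliary alphabet `Fin k`). -/
def IqUY {k : ℕ} (W : 𝒳 → 𝒮 → 𝒴 × 𝒴₁ → ℝ) (p : Fin k × 𝒳 → ℝ) (q : 𝒮 → ℝ) : ℝ :=
  mutInfo (fun uy : Fin k × 𝒴 => ∑ x, ∑ s, ∑ y1, p (uy.1, x) * q s * W x s (uy.2, y1))

/-- `I_q(U;Y₁)` under input pmf `p(u,x)`. -/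
def IqUY1 {k : ℕ} (W : 𝒳 → 𝒮 → 𝒴 × 𝒴₁ → ℝ) (p : Fin k × 𝒳 → ℝ) (q : 𝒮 → ℝ) : ℝ :=
  mutInfo (fun uy : Fin k × 𝒴₁ => ∑ x, ∑ s, ∑ y, p (uy.1, x) * q s * W x s (y, uy.2))

/-- `I_q(X;Y|U)` under input pmf `p(u,x)`. -/
def IqXYgivenU {k : ℕ} (W : 𝒳 → 𝒮 → 𝒴 × 𝒴₁ → ℝ) (p : Fin k × 𝒳 → ℝ) (q : 𝒮 → ℝ) : ℝ :=
  condMutInfo (fun uxy : Fin k × 𝒳 × 𝒴 =>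
    p (uxy.1, uxy.2.1) * ∑ s, q s * ∑ y1, W uxy.2.1 s (uxy.2.2, y1))

/-- The partial decode-forward lower bound `R_DF(Q)`: the supremum over all finite
auxiliary alphabets (represented by `Fin k`) and input pmfs `p(u,x)` of
`min{ inf_q I_q(U;Y) + inf_q I_q(X;Y|U) + C₁, inf_q I_q(U;Y₁) + inf_q I_q(X;Y|U) }`. -/
def RDF (W : 𝒳 → 𝒮 → 𝒴 × 𝒴₁ → ℝ) (C1 : ℝ) (Q : Set (𝒮 → ℝ)) : ℝ :=
  sSup {r | ∃ (k : ℕ) (p : Fin k × 𝒳 → ℝ), IsPMF p ∧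
    r = min
      (sInf {v | ∃ q ∈ Q, v = IqUY W p q} + sInf {v | ∃ q ∈ Q, v = IqXYgivenU W p q} + C1)
      (sInf {v | ∃ q ∈ Q, v = IqUY1 W p q} + sInf {v | ∃ q ∈ Q, v = IqXYgivenU W p q})}

/-- The cutset upper bound
`R_CS(Q) = inf_{q∈Q} max_{p(x)} min{ I_q(X;Y) + C₁, I_q(X;Y,Y₁) }`. -/
def RCS (W : 𝒳 → 𝒮 → 𝒴 × 𝒴₁ → ℝ) (C1 : ℝ) (Q : Set (𝒮 → ℝ)) : ℝ :=
  sInf {r | ∃ q ∈ Q, r = sSup {v | ∃ p : 𝒳 → ℝ, IsPMF p ∧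
    v = min (IqXY W p q + C1) (IqXYY1 W p q)}}

end InfoQuantities

/-- A deterministic code for the primitive relay channel: a message encoder, a relay
function mapping the relay's received block to one of `L` indices sent over the
noiseless link, and a decoder using the channel output together with that index. -/
structure PCode (𝒳 𝒴 𝒴₁ : Type) (n M L : ℕ) where
  f : Fin M → Fin n → 𝒳
  f1 : (Fin n → 𝒴₁) → Fin L
  g : (Fin n → 𝒴) × Fin L → Fin M

/-- The noiseless link of rate `C₁` supports `L` indices when `L ≤ 2^{nC₁}`. -/
def LinkOK (n L : ℕ) (C1 : ℝ) : Prop := 1 ≤ L ∧ (L : ℝ) ≤ (2 : ℝ) ^ ((n : ℝ) * C1)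

section Codes

variable {𝒳 𝒮 𝒴 𝒴₁ : Type} [Fintype 𝒳] [Fintype 𝒮] [Fintype 𝒴] [Fintype 𝒴₁]
variable {n M L : ℕ}

/-- Conditional probability of error of the code given the state sequence `s`. -/
def PCode.errGiven (C : PCode 𝒳 𝒴 𝒴₁ n M L) (W : 𝒳 → 𝒮 → 𝒴 × 𝒴₁ → ℝ)
    (s : Fin n → 𝒮) : ℝ :=
  (M : ℝ)⁻¹ * ∑ m : Fin M, ∑ y : Fin n → 𝒴, ∑ y1 : Fin n → 𝒴₁,
    if C.g (y, C.f1 y1) = m then 0 else ∏ i, W (C.f m i) (s i) (y i, y1 i)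

/-- Average error probability under an i.i.d. state distribution `q`. -/
def PCode.errIID (C : PCode 𝒳 𝒴 𝒴₁ n M L) (W : 𝒳 → 𝒮 → 𝒴 × 𝒴₁ → ℝ)
    (q : 𝒮 → ℝ) : ℝ :=
  ∑ s : Fin n → 𝒮, (∏ i, q (s i)) * C.errGiven W s

/-- Average error probability under an arbitrary joint state distribution `qn`. -/
def PCode.errJoint (C : PCode 𝒳 𝒴 𝒴₁ n M L) (W : 𝒳 → 𝒮 → 𝒴 × 𝒴₁ → ℝ)
    (qn : (Fin n → 𝒮) → ℝ) : ℝ :=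
  ∑ s : Fin n → 𝒮, qn s * C.errGiven W s

end Codes

section Capacities

variable {𝒳 𝒮 𝒴 𝒴₁ : Type} [Fintype 𝒳] [Fintype 𝒮] [Fintype 𝒴] [Fintype 𝒴₁]

/-- `R` is achievable by deterministic codes over the compound primitive relay
channel with state set `Q`. -/
def CompAchievable (W : 𝒳 → 𝒮 → 𝒴 × 𝒴₁ → ℝ) (C1 : ℝ) (Q : Set (𝒮 → ℝ)) (R : ℝ) : Prop :=
  ∀ ε > (0 : ℝ), ∃ N : ℕ, ∀ n ≥ N, ∃ (M L : ℕ) (C : PCode 𝒳 𝒴 𝒴₁ n M L),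
    (2 : ℝ) ^ ((n : ℝ) * R) ≤ (M : ℝ) ∧ LinkOK n L C1 ∧
    ∀ q ∈ Q, C.errIID W q ≤ ε

/-- The deterministic code capacity of the compound primitive relay channel. -/
def CompCapacity (W : 𝒳 → 𝒮 → 𝒴 × 𝒴₁ → ℝ) (C1 : ℝ) (Q : Set (𝒮 → ℝ)) : ℝ :=
  sSup {R | CompAchievable W C1 Q R}

/-- `R` is achievable by random codes over the compound primitive relay channel. -/
def CompRandAchievable (W : 𝒳 → 𝒮 → 𝒴 × 𝒴₁ → ℝ) (C1 : ℝ) (Q : Set (𝒮 → ℝ)) (R : ℝ) :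
    Prop :=
  ∀ ε > (0 : ℝ), ∃ N : ℕ, ∀ n ≥ N, ∃ (M L : ℕ),
    (2 : ℝ) ^ ((n : ℝ) * R) ≤ (M : ℝ) ∧ LinkOK n L C1 ∧
    ∃ (J : Type) (π : PMF J) (Cs : J → PCode 𝒳 𝒴 𝒴₁ n M L),
      ∀ q ∈ Q, (∑' j, π j * ENNReal.ofReal ((Cs j).errIID W q)) ≤ ENNReal.ofReal ε

/-- The random code capacity of the compound primitive relay channel. -/
def CompRandCapacity (W : 𝒳 → 𝒮 → 𝒴 × 𝒴₁ → ℝ) (C1 : ℝ) (Q : Set (𝒮 → ℝ)) : ℝ :=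
  sSup {R | CompRandAchievable W C1 Q R}

/-- `R` is achievable by deterministic codes over the primitive AVRC: the average
error is small under every joint state distribution. -/
def AVRCAchievable (W : 𝒳 → 𝒮 → 𝒴 × 𝒴₁ → ℝ) (C1 R : ℝ) : Prop :=
  ∀ ε > (0 : ℝ), ∃ N : ℕ, ∀ n ≥ N, ∃ (M L : ℕ) (C : PCode 𝒳 𝒴 𝒴₁ n M L),
    (2 : ℝ) ^ ((n : ℝ) * R) ≤ (M : ℝ) ∧ LinkOK n L C1 ∧
    ∀ qn : (Fin n → 𝒮) → ℝ, IsPMF qn → C.errJoint W qn ≤ ε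

/-- The deterministic code capacity of the primitive AVRC. -/
def AVRCCapacity (W : 𝒳 → 𝒮 → 𝒴 × 𝒴₁ → ℝ) (C1 : ℝ) : ℝ :=
  sSup {R | AVRCAchievable W C1 R}

/-- `R` is achievable by random codes over the primitive AVRC. -/
def AVRCRandAchievable (W : 𝒳 → 𝒮 → 𝒴 × 𝒴₁ → ℝ) (C1 R : ℝ) : Prop :=
  ∀ ε > (0 : ℝ), ∃ N : ℕ, ∀ n ≥ N, ∃ (M L : ℕ),
    (2 : ℝ) ^ ((n : ℝ) * R) ≤ (M : ℝ) ∧ LinkOK n L C1 ∧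
    ∃ (J : Type) (π : PMF J) (Cs : J → PCode 𝒳 𝒴 𝒴₁ n M L),
      ∀ qn : (Fin n → 𝒮) → ℝ, IsPMF qn →
        (∑' j, π j * ENNReal.ofReal ((Cs j).errJoint W qn)) ≤ ENNReal.ofReal ε

/-- The random code capacity of the primitive AVRC. -/
def AVRCRandCapacity (W : 𝒳 → 𝒮 → 𝒴 × 𝒴₁ → ℝ) (C1 : ℝ) : ℝ :=
  sSup {R | AVRCRandAchievable W C1 R}

end Capacities

/-- The channel is reversely strongly degraded:
`W(y,y₁|x,s) = W_{Y|X,S}(y|x,s)·W_{Y₁|Y}(y₁|y)`. -/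
def RevStronglyDegraded {𝒳 𝒮 𝒴 𝒴₁ : Type} [Fintype 𝒴] [Fintype 𝒴₁]
    (W : 𝒳 → 𝒮 → 𝒴 × 𝒴₁ → ℝ) : Prop :=
  ∃ (WY : 𝒳 → 𝒮 → 𝒴 → ℝ) (V : 𝒴 → 𝒴₁ → ℝ),
    (∀ x s, IsPMF (WY x s)) ∧ (∀ y, IsPMF (V y)) ∧
    ∀ x s y y1, W x s (y, y1) = WY x s y * V y y1

/-- A state-dependent DMC `V(z|x,s)` is symmetrizable. -/
def Symmetrizable {𝒳 𝒮 𝒵 : Type} [Fintype 𝒮] (V : 𝒳 → 𝒮 → 𝒵 → ℝ) : Prop :=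
  ∃ J : 𝒳 → 𝒮 → ℝ, (∀ x, IsPMF (J x)) ∧
    ∀ x x' z, (∑ s, V x s z * J x' s) = ∑ s, V x' s z * J x s

theorem sum_prod_apply {ι A : Type} [Fintype ι] [DecidableEq ι] [Fintype A] (f : ι → A → ℝ) :
    ∑ z : ι → A, ∏ i, f i (z i) = ∏ i, ∑ a, f i a := by
  rw [Fintype.prod_sum]

/-- Moment generating function bound for sums of independent bounded variables. -/
theorem sum_prod_mul_exp_le {ι A : Type} [Fintype ι] [DecidableEq ι] [Fintype A] (w ξ : ι → A → ℝ)
    (hw : ∀ i a, 0 ≤ w i a) (hw1 : ∀ i, ∑ a, w i a = 1) {B m l : ℝ} (hl : 0 ≤ l)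
    (hB : ∀ i a, |ξ i a| ≤ B) (hlB : l * B ≤ 1) (hm : ∀ i, m ≤ ∑ a, w i a * ξ i a) :
    ∑ z : ι → A, (∏ i, w i (z i)) * Real.exp (-(l * ∑ i, ξ i (z i)))
      ≤ Real.exp (Fintype.card ι * (l ^ 2 * B ^ 2 - l * m)) := by
  have h1 : ∀ z : ι → A, (∏ i, w i (z i)) * Real.exp (-(l * ∑ i, ξ i (z i)))
      = ∏ i, (w i (z i) * Real.exp (-(l * ξ i (z i)))) := by
    intro z
    rw [Finset.prod_mul_distrib, ← Real.exp_sum, Finset.mul_sum, Finset.sum_neg_distrib]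
  simp_rw [h1]
  rw [sum_prod_apply (fun i a => w i a * Real.exp (-(l * ξ i a)))]
  have h2 : ∀ i, ∑ a, w i a * Real.exp (-(l * ξ i a)) ≤ Real.exp (l ^ 2 * B ^ 2 - l * m) := by
    intro i
    have h3 : ∀ a, w i a * Real.exp (-(l * ξ i a))
        ≤ w i a * (1 + l ^ 2 * B ^ 2) - l * (w i a * ξ i a) := by
      intro a
      have hb : |l * ξ i a| ≤ l * B := by
        rw [abs_mul, abs_of_nonneg hl]
        exact mul_le_mul_of_nonneg_left (hB i a) hl
      have h4 := Real.abs_exp_sub_one_sub_id_le (x := -(l * ξ i a))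
        (by rw [abs_neg]; exact hb.trans hlB)
      have h5 : (-(l * ξ i a)) ^ 2 ≤ l ^ 2 * B ^ 2 := by
        rw [← mul_pow, neg_sq]
        exact sq_le_sq' (by linarith [neg_le_of_abs_le hb]) (le_of_abs_le hb)
      have h6 : Real.exp (-(l * ξ i a)) ≤ 1 + l ^ 2 * B ^ 2 - l * ξ i a := by
        linarith [le_of_abs_le h4]
      calc w i a * Real.exp (-(l * ξ i a))
          ≤ w i a * (1 + l ^ 2 * B ^ 2 - l * ξ i a) := mul_le_mul_of_nonneg_left h6 (hw i a)
        _ = _ := by ring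
    calc ∑ a, w i a * Real.exp (-(l * ξ i a))
        ≤ ∑ a, (w i a * (1 + l ^ 2 * B ^ 2) - l * (w i a * ξ i a)) :=
          Finset.sum_le_sum fun a _ => h3 a
      _ = 1 + l ^ 2 * B ^ 2 - l * ∑ a, w i a * ξ i a := by
          rw [Finset.sum_sub_distrib, ← Finset.sum_mul, hw1, ← Finset.mul_sum, one_mul]
      _ ≤ (l ^ 2 * B ^ 2 - l * m) + 1 := by
          have := mul_le_mul_of_nonneg_left (hm i) hl
          linarith
      _ ≤ _ := Real.add_one_le_exp _
  calc ∏ i, ∑ a, w i a * Real.exp (-(l * ξ i a))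
      ≤ ∏ _i : ι, Real.exp (l ^ 2 * B ^ 2 - l * m) :=
        Finset.prod_le_prod (fun i _ => Finset.sum_nonneg fun a _ =>
          mul_nonneg (hw i a) (Real.exp_nonneg _)) fun i _ => h2 i
    _ = _ := by
        rw [Finset.prod_const, Finset.card_univ, ← Real.exp_nat_mul]

section MutualInformation

variable {X S Y : Type} [Fintype X] [Fintype S] [Fintype Y]

/-- Output distribution of a channel `U` under the input distribution `p`. -/
def outDist (p : X → ℝ) (U : X → Y → ℝ) (y : Y) : ℝ := ∑ x, p x * U x y

/-- The state-averaged channel. -/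
def avgCh (V : X → S → Y → ℝ) (q : S → ℝ) (x : X) (y : Y) : ℝ := ∑ s, q s * V x s y

/-- Mutual information, in nats, of input distribution `p` and channel `U`. -/
def natMI (p : X → ℝ) (U : X → Y → ℝ) : ℝ :=
  ∑ x, p x * ∑ y, U x y * Real.log (U x y) - ∑ y, outDist p U y * Real.log (outDist p U y)

theorem outDist_nonneg {X Y : Type} [Fintype X] {p : X → ℝ} {U : X → Y → ℝ} (hp : ∀ x, 0 ≤ p x)
    (hU : ∀ x y, 0 ≤ U x y)
    (y : Y) : 0 ≤ outDist p U y :=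
  Finset.sum_nonneg fun x _ => mul_nonneg (hp x) (hU x y)

theorem mul_eq_zero_of_outDist_eq_zero {X Y : Type} [Fintype X] {p : X → ℝ} {U : X → Y → ℝ}
    (hp : ∀ x, 0 ≤ p x)
    (hU : ∀ x y, 0 ≤ U x y) {y : Y} (h : outDist p U y = 0) (x : X) : p x * U x y = 0 :=
  (Finset.sum_eq_zero_iff_of_nonneg fun x _ => mul_nonneg (hp x) (hU x y)).1 h x
    (Finset.mem_univ x)

theorem sum_outDist {p : X → ℝ} {U : X → Y → ℝ} (hp : IsPMF p) (hU : ∀ x, IsPMF (U x)) :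
    ∑ y, outDist p U y = 1 := by
  unfold outDist
  rw [Finset.sum_comm]
  simp_rw [← Finset.mul_sum, (hU _).2, mul_one, hp.2]

theorem avgCh_isPMF {X S Y : Type} [Fintype S] [Fintype Y] {V : X → S → Y → ℝ} (hV : IsChannel V)
    {q : S → ℝ} (hq : IsPMF q) (x : X) :
    IsPMF (avgCh V q x) := by
  refine ⟨fun y => Finset.sum_nonneg fun s _ => mul_nonneg (hq.1 s) ((hV x s).1 y), ?_⟩
  unfold avgCh
  rw [Finset.sum_comm]
  simp_rw [← Finset.mul_sum, (hV x _).2, mul_one, hq.2]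

theorem natMI_eq_sum_log_div {p : X → ℝ} {U : X → Y → ℝ} (hp : ∀ x, 0 ≤ p x)
    (hU : ∀ x y, 0 ≤ U x y) :
    natMI p U = ∑ y, ∑ x, p x * U x y * Real.log (U x y / outDist p U y) := by
  have h : ∀ y x, p x * U x y * Real.log (U x y / outDist p U y)
      = p x * (U x y * Real.log (U x y)) - p x * U x y * Real.log (outDist p U y) := by
    intro y x
    by_cases h0 : p x * U x y = 0
    · rw [← mul_assoc, h0]; ring
    · have h1 : outDist p U y ≠ 0 := fun h1 => h0 (mul_eq_zero_of_outDist_eq_zero hp hU h1 x)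
      rw [Real.log_div (right_ne_zero_of_mul h0) h1]; ring
  simp_rw [h, Finset.sum_sub_distrib, natMI, ← Finset.sum_mul]
  rw [Finset.sum_comm]
  simp_rw [Finset.mul_sum]
  rfl

theorem mul_log_div_ge {a b : ℝ} (ha : 0 ≤ a) (hb : 0 ≤ b) (h : b = 0 → a = 0) :
    a - b ≤ a * Real.log (a / b) := by
  rcases ha.eq_or_lt with rfl | ha'
  · simpa using hb
  have hb' : 0 < b := hb.lt_of_ne fun h0 => ha'.ne' (h h0.symm)
  have := Real.one_sub_inv_le_log_of_pos (div_pos ha' hb')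
  have h2 := mul_le_mul_of_nonneg_left this ha
  have : a * (1 - (a / b)⁻¹) = a - b := by field_simp
  linarith

theorem mul_log_div_le {a b : ℝ} (ha : 0 ≤ a) (hb : 0 ≤ b) (h : b = 0 → a = 0) :
    a * Real.log (a / b) ≤ (a - b) ^ 2 / b + (a - b) := by
  rcases hb.eq_or_lt with rfl | hb'
  · simp [h rfl]
  rcases ha.eq_or_lt with rfl | ha'
  · have : (0 - b) ^ 2 / b + (0 - b) = 0 := by field_simp; ring
    simp only [zero_mul]
    exact this.ge
  have := Real.log_le_sub_one_of_pos (div_pos ha' hb')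
  have h2 := mul_le_mul_of_nonneg_left this ha
  have : a * (a / b - 1) = (a - b) ^ 2 / b + (a - b) := by field_simp; ring
  linarith

/-- Replacing the reference channel can only decrease the expected information density. -/
theorem sum_log_div_le_natMI {p : X → ℝ} {U U0 : X → Y → ℝ} (hp : ∀ x, 0 ≤ p x)
    (hU : ∀ x y, 0 ≤ U x y) (hU0 : ∀ x y, 0 ≤ U0 x y) (hac : ∀ x y, U0 x y = 0 → U x y = 0) :
    ∑ y, ∑ x, p x * U x y * Real.log (U0 x y / outDist p U0 y) ≤ natMI p U := by
  rw [natMI_eq_sum_log_div hp hU]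
  refine Finset.sum_le_sum fun y _ => ?_
  set P := outDist p U y with hP
  set P0 := outDist p U0 y with hP0
  have hPn : 0 ≤ P := outDist_nonneg hp hU y
  have hP0n : 0 ≤ P0 := outDist_nonneg hp hU0 y
  have key : ∀ x, p x * U x y * Real.log (U0 x y / P0) + (p x * U x y - p x * U0 x y * (P / P0))
      ≤ p x * U x y * Real.log (U x y / P) := by
    intro x
    by_cases h0 : p x * U x y = 0
    · rw [h0]
      have : 0 ≤ p x * U0 x y * (P / P0) :=
        mul_nonneg (mul_nonneg (hp x) (hU0 x y)) (div_nonneg hPn hP0n)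
      linarith
    · have hu : 0 < U x y := (hU x y).lt_of_ne' (right_ne_zero_of_mul h0)
      have hp' : 0 < p x := (hp x).lt_of_ne' (left_ne_zero_of_mul h0)
      have hu0 : 0 < U0 x y := (hU0 x y).lt_of_ne' fun h => hu.ne' (hac x y h)
      have hP' : 0 < P := hPn.lt_of_ne' fun h => h0 (mul_eq_zero_of_outDist_eq_zero hp hU h x)
      have hP0' : 0 < P0 := hP0n.lt_of_ne' fun h =>
        (mul_pos hp' hu0).ne' (mul_eq_zero_of_outDist_eq_zero hp hU0 h x)
      have h1 := mul_log_div_ge (a := U x y / P) (b := U0 x y / P0) (by positivity) (by positivity)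
        (fun h => absurd h (by positivity))
      rw [Real.log_div (by positivity) (by positivity)] at h1
      have h2 := mul_le_mul_of_nonneg_left h1 (mul_pos hp' hP').le
      have h3 : p x * P * (U x y / P - U0 x y / P0) = p x * U x y - p x * U0 x y * (P / P0) := by
        field_simp
      have h4 : p x * P * (U x y / P * (Real.log (U x y / P) - Real.log (U0 x y / P0)))
          = p x * U x y * Real.log (U x y / P) - p x * U x y * Real.log (U0 x y / P0) := by
        field_simp
      linarith
  have h5 : 0 ≤ ∑ x, (p x * U x y - p x * U0 x y * (P / P0)) := by
    rw [Finset.sum_sub_distrib, ← Finset.sum_mul]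
    change 0 ≤ P - P0 * (P / P0)
    by_cases h : P0 = 0
    · rw [h]; simpa using hPn
    · rw [mul_div_cancel₀ _ h]; simp
  calc _ ≤ ∑ x, p x * U x y * Real.log (U0 x y / P0)
        + ∑ x, (p x * U x y - p x * U0 x y * (P / P0)) := by linarith
    _ ≤ _ := by
        rw [← Finset.sum_add_distrib]
        exact Finset.sum_le_sum fun x _ => key x

theorem natMI_le_sum_log_div_add {p : X → ℝ} {U U0 : X → Y → ℝ} (hp : ∀ x, 0 ≤ p x)
    (hU : ∀ x y, 0 ≤ U x y) (hU0 : ∀ x y, 0 ≤ U0 x y) (hac : ∀ x y, U0 x y = 0 → U x y = 0) :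
    natMI p U ≤ ∑ y, ∑ x, p x * U x y * Real.log (U0 x y / outDist p U0 y)
      + ∑ y, ∑ x, p x * ((U x y - U0 x y) ^ 2 / U0 x y) := by
  rw [natMI_eq_sum_log_div hp hU, ← Finset.sum_add_distrib]
  refine Finset.sum_le_sum fun y _ => ?_
  set P := outDist p U y with hP
  set P0 := outDist p U0 y with hP0
  have hPn : 0 ≤ P := outDist_nonneg hp hU y
  have hP0n : 0 ≤ P0 := outDist_nonneg hp hU0 y
  have hPac : P0 = 0 → P = 0 := by
    intro h
    refine Finset.sum_eq_zero fun x _ => ?_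
    rcases mul_eq_zero.1 (mul_eq_zero_of_outDist_eq_zero hp hU0 h x) with h | h
    · rw [h, zero_mul]
    · rw [hac x y h, mul_zero]
  have key : ∀ x, p x * U x y * Real.log (U x y / P)
      ≤ p x * U x y * Real.log (U0 x y / P0) + p x * ((U x y - U0 x y) ^ 2 / U0 x y)
        + (p x * U x y - p x * U0 x y) - p x * U x y * Real.log (P / P0) := by
    intro x
    by_cases h0 : p x * U x y = 0
    · have h1 := mul_le_mul_of_nonneg_left (mul_log_div_le (hU x y) (hU0 x y) (hac x y)) (hp x)
      rw [← mul_assoc, h0] at h1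
      rw [h0]
      nlinarith
    · have hu : 0 < U x y := (hU x y).lt_of_ne' (right_ne_zero_of_mul h0)
      have hp' : 0 < p x := (hp x).lt_of_ne' (left_ne_zero_of_mul h0)
      have hu0 : 0 < U0 x y := (hU0 x y).lt_of_ne' fun h => hu.ne' (hac x y h)
      have hP' : 0 < P := hPn.lt_of_ne' fun h => h0 (mul_eq_zero_of_outDist_eq_zero hp hU h x)
      have hP0' : 0 < P0 := hP0n.lt_of_ne' fun h => hP'.ne' (hPac h)
      have h1 := mul_le_mul_of_nonneg_left (mul_log_div_le (hU x y) (hU0 x y) (hac x y)) (hp x)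
      rw [Real.log_div hu.ne' hu0.ne'] at h1
      rw [Real.log_div hu.ne' hP'.ne', Real.log_div hu0.ne' hP0'.ne',
        Real.log_div hP'.ne' hP0'.ne']
      nlinarith
  have h6 : P - P0 ≤ P * Real.log (P / P0) := mul_log_div_ge hPn hP0n hPac
  calc _ ≤ ∑ x, (p x * U x y * Real.log (U0 x y / P0) + p x * ((U x y - U0 x y) ^ 2 / U0 x y)
        + (p x * U x y - p x * U0 x y) - p x * U x y * Real.log (P / P0)) :=
        Finset.sum_le_sum fun x _ => key x
    _ = ∑ x, p x * U x y * Real.log (U0 x y / P0) + ∑ x, p x * ((U x y - U0 x y) ^ 2 / U0 x y)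
        + (P - P0) - P * Real.log (P / P0) := by
        rw [Finset.sum_sub_distrib, Finset.sum_add_distrib, Finset.sum_add_distrib,
          Finset.sum_sub_distrib, ← Finset.sum_mul]
        rfl
    _ ≤ _ := by linarith

theorem sum_log_div_sub_le_natMI {p p0 : X → ℝ} {U : X → Y → ℝ} (hp : ∀ x, 0 ≤ p x)
    (hp0 : ∀ x, 0 ≤ p0 x) (hU : ∀ x y, 0 ≤ U x y)
    (hac : ∀ x y, outDist p0 U y = 0 → U x y = 0) :
    ∑ y, ∑ x, p x * U x y * Real.log (U x y / outDist p0 U y)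
      - ∑ y, (outDist p U y - outDist p0 U y) ^ 2 / outDist p0 U y
      - (∑ y, outDist p U y - ∑ y, outDist p0 U y) ≤ natMI p U := by
  rw [natMI_eq_sum_log_div hp hU, ← Finset.sum_sub_distrib, ← Finset.sum_sub_distrib,
    ← Finset.sum_sub_distrib]
  refine Finset.sum_le_sum fun y _ => ?_
  set P := outDist p U y with hP
  set P0 := outDist p0 U y with hP0
  have hPn : 0 ≤ P := outDist_nonneg hp hU y
  have hP0n : 0 ≤ P0 := outDist_nonneg hp0 hU y
  have hPac : P0 = 0 → P = 0 := fun h => Finset.sum_eq_zero fun x _ => by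
    rw [hac x y h, mul_zero]
  have key : ∀ x, p x * U x y * Real.log (U x y / P)
      = p x * U x y * Real.log (U x y / P0) - p x * U x y * Real.log (P / P0) := by
    intro x
    by_cases h0 : p x * U x y = 0
    · rw [h0]; ring
    · have hu : 0 < U x y := (hU x y).lt_of_ne' (right_ne_zero_of_mul h0)
      have hP' : 0 < P := hPn.lt_of_ne' fun h => h0 (mul_eq_zero_of_outDist_eq_zero hp hU h x)
      have hP0' : 0 < P0 := hP0n.lt_of_ne' fun h => hP'.ne' (hPac h)
      rw [Real.log_div hu.ne' hP'.ne', Real.log_div hu.ne' hP0'.ne',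
        Real.log_div hP'.ne' hP0'.ne']
      ring
  simp_rw [key]
  rw [Finset.sum_sub_distrib, ← Finset.sum_mul]
  change _ ≤ _ - P * Real.log (P / P0)
  have := mul_log_div_le hPn hP0n hPac
  linarith

theorem nonpos_of_forall_mul_le_sq {a c : ℝ} (h : ∀ t : ℝ, 0 < t → t ≤ 1 → t * a ≤ c * t ^ 2) :
    a ≤ 0 := by
  by_contra! ha
  have hc : 0 ≤ |c| := abs_nonneg c
  set t := a / (a + |c| + |c|) with ht
  have hden : 0 < a + |c| + |c| := by positivity
  have ht0 : 0 < t := div_pos ha hden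
  have ht1 : t ≤ 1 := (div_le_one hden).2 (by linarith)
  have h1 := h t ht0 ht1
  have h2 : a ≤ c * t := by nlinarith
  have h3 : c * t ≤ |c| * t := mul_le_mul_of_nonneg_right (le_abs_self c) ht0.le
  have h4 : t * (a + |c| + |c|) = a := div_mul_cancel₀ _ hden.ne'
  nlinarith

/-- Probability vectors whose entries are all at least `η`. -/
def innerSimplex (A : Type) [Fintype A] (η : ℝ) : Set (A → ℝ) :=
  {p | (∀ a, η ≤ p a) ∧ ∑ a, p a = 1}

theorem convex_innerSimplex (A : Type) [Fintype A] (η : ℝ) : Convex ℝ (innerSimplex A η) := by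
  intro p hp q hq a b ha hb hab
  refine ⟨fun i => ?_, ?_⟩
  · have h1 := mul_le_mul_of_nonneg_left (hp.1 i) ha
    have h2 := mul_le_mul_of_nonneg_left (hq.1 i) hb
    simp only [Pi.add_apply, Pi.smul_apply, smul_eq_mul]
    have : a * η + b * η = η := by rw [← add_mul, hab, one_mul]
    linarith
  · simp only [Pi.add_apply, Pi.smul_apply, smul_eq_mul, Finset.sum_add_distrib, ← Finset.mul_sum,
      hp.2, hq.2, mul_one, hab]

theorem isPMF_of_mem_innerSimplex {A : Type} [Fintype A] {η : ℝ} (hη : 0 ≤ η) {p : A → ℝ}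
    (hp : p ∈ innerSimplex A η) : IsPMF p :=
  ⟨fun a => hη.trans (hp.1 a), hp.2⟩

theorem isCompact_innerSimplex (A : Type) [Fintype A] {η : ℝ} (hη : 0 ≤ η) :
    IsCompact (innerSimplex A η) := by
  refine (isCompact_stdSimplex ℝ A).of_isClosed_subset ?_ fun p hp =>
    isPMF_of_mem_innerSimplex hη hp
  have : innerSimplex A η = (⋂ a, {p | η ≤ p a}) ∩ {p | ∑ a, p a = 1} := by
    ext p; simp [innerSimplex]
  rw [this]
  exact (isClosed_iInter fun a => isClosed_le continuous_const (continuous_apply a)).inter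
    (isClosed_eq (continuous_finsetSum _ fun a _ => continuous_apply a) continuous_const)

/-- A vertex of the inner simplex. -/
def innerVertex {A : Type} [Fintype A] [DecidableEq A] (η : ℝ) (a b : A) : ℝ :=
  (if b = a then 1 - Fintype.card A * η else 0) + η

theorem innerVertex_mem {A : Type} [Fintype A] [DecidableEq A] {η : ℝ}
    (hη : Fintype.card A * η ≤ 1) (a : A) : innerVertex η a ∈ innerSimplex A η := by
  refine ⟨fun b => ?_, ?_⟩
  · unfold innerVertex
    split_ifs
    · linarith
    · simp
  · simp [innerVertex, Finset.sum_add_distrib]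

theorem sum_innerVertex_mul {A : Type} [Fintype A] [DecidableEq A] (η : ℝ) (a : A) (g : A → ℝ) :
    ∑ b, innerVertex η a b * g b = (1 - Fintype.card A * η) * g a + η * ∑ b, g b := by
  simp [innerVertex, add_mul, Finset.sum_add_distrib, Finset.mul_sum]

theorem continuous_natMI_left (U : X → Y → ℝ) : Continuous fun p => natMI p U := by
  unfold natMI outDist
  refine Continuous.sub (by fun_prop) ?_
  exact continuous_finsetSum _ fun y _ => Real.Continuous.mul_log (by fun_prop)

theorem continuous_natMI_right (p : X → ℝ) (V : X → S → Y → ℝ) :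
    Continuous fun q => natMI p (avgCh V q) := by
  unfold natMI outDist avgCh
  refine Continuous.sub ?_ ?_
  · refine continuous_finsetSum _ fun x _ => continuous_const.mul ?_
    exact continuous_finsetSum _ fun y _ => Real.Continuous.mul_log (by fun_prop)
  · exact continuous_finsetSum _ fun y _ => Real.Continuous.mul_log (by fun_prop)

theorem outDist_linear {X Y : Type} [Fintype X] (p p' : X → ℝ) (U : X → Y → ℝ) (a b : ℝ) (y : Y) :
    outDist (a • p + b • p') U y = a * outDist p U y + b * outDist p' U y := by
  simp only [outDist, Pi.add_apply, Pi.smul_apply, smul_eq_mul, add_mul, Finset.sum_add_distrib,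
    Finset.mul_sum, mul_assoc]

theorem avgCh_linear {X S Y : Type} [Fintype S] (V : X → S → Y → ℝ) (q q' : S → ℝ) (a b : ℝ)
    (x : X) (y : Y) :
    avgCh V (a • q + b • q') x y = a * avgCh V q x y + b * avgCh V q' x y := by
  simp only [avgCh, Pi.add_apply, Pi.smul_apply, smul_eq_mul, add_mul, Finset.sum_add_distrib,
    Finset.mul_sum, mul_assoc]

theorem concaveOn_natMI {U : X → Y → ℝ} (hU : ∀ x y, 0 ≤ U x y) {s : Set (X → ℝ)}
    (hs : Convex ℝ s) (hs0 : ∀ p ∈ s, ∀ x, 0 ≤ p x) : ConcaveOn ℝ s fun p => natMI p U := by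
  refine ⟨hs, fun p hp p' hp' a b ha hb hab => ?_⟩
  simp only [smul_eq_mul, natMI]
  have h1 : ∑ x, (a • p + b • p') x * ∑ y, U x y * Real.log (U x y)
      = a * ∑ x, p x * ∑ y, U x y * Real.log (U x y)
        + b * ∑ x, p' x * ∑ y, U x y * Real.log (U x y) := by
    simp only [Pi.add_apply, Pi.smul_apply, smul_eq_mul, add_mul, Finset.sum_add_distrib,
      Finset.mul_sum, mul_assoc]
  have h2 : ∑ y, outDist (a • p + b • p') U y * Real.log (outDist (a • p + b • p') U y)
      ≤ a * ∑ y, outDist p U y * Real.log (outDist p U y)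
        + b * ∑ y, outDist p' U y * Real.log (outDist p' U y) := by
    rw [Finset.mul_sum, Finset.mul_sum, ← Finset.sum_add_distrib]
    refine Finset.sum_le_sum fun y _ => ?_
    rw [outDist_linear]
    exact Real.convexOn_mul_log.2 (outDist_nonneg (hs0 p hp) hU y)
      (outDist_nonneg (hs0 p' hp') hU y) ha hb hab
  rw [h1]
  linarith

theorem avgCh_nonneg {X S Y : Type} [Fintype S] [Fintype Y] {V : X → S → Y → ℝ} (hV : IsChannel V)
    {q : S → ℝ} (hq : ∀ s, 0 ≤ q s)
    (x : X) (y : Y) : 0 ≤ avgCh V q x y :=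
  Finset.sum_nonneg fun s _ => mul_nonneg (hq s) ((hV x s).1 y)

theorem convexOn_natMI {V : X → S → Y → ℝ} (hV : IsChannel V) {p : X → ℝ} (hp : ∀ x, 0 ≤ p x)
    {s : Set (S → ℝ)} (hs : Convex ℝ s) (hs0 : ∀ q ∈ s, ∀ x, 0 ≤ q x) :
    ConvexOn ℝ s fun q => natMI p (avgCh V q) := by
  refine ⟨hs, fun q hq q' hq' a b ha hb hab => ?_⟩
  rcases ha.eq_or_lt with rfl | ha'
  · simp [show b = 1 by linarith]
  rcases hb.eq_or_lt with rfl | hb'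
  · simp [show a = 1 by linarith]
  have hm := hs hq hq' ha hb hab
  have hU := avgCh_nonneg hV (hs0 q hq)
  have hU' := avgCh_nonneg hV (hs0 q' hq')
  have hU0 := avgCh_nonneg hV (hs0 _ hm)
  have hz : ∀ x y, avgCh V (a • q + b • q') x y = 0 → avgCh V q x y = 0 ∧ avgCh V q' x y = 0 := by
    intro x y h
    rw [avgCh_linear] at h
    have h1 := mul_nonneg ha (hU x y)
    have h2 := mul_nonneg hb (hU' x y)
    constructor
    · exact (mul_eq_zero.1 (show a * avgCh V q x y = 0 by linarith)).resolve_left ha'.ne'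
    · exact (mul_eq_zero.1 (show b * avgCh V q' x y = 0 by linarith)).resolve_left hb'.ne'
  have h1 := sum_log_div_le_natMI hp hU hU0 fun x y h => (hz x y h).1
  have h2 := sum_log_div_le_natMI hp hU' hU0 fun x y h => (hz x y h).2
  have h3 := natMI_eq_sum_log_div hp hU0
  have h4 : natMI p (avgCh V (a • q + b • q'))
      = a * ∑ y, ∑ x, p x * avgCh V q x y * Real.log (avgCh V (a • q + b • q') x y /
          outDist p (avgCh V (a • q + b • q')) y)
        + b * ∑ y, ∑ x, p x * avgCh V q' x y * Real.log (avgCh V (a • q + b • q') x y /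
          outDist p (avgCh V (a • q + b • q')) y) := by
    rw [h3, Finset.mul_sum, Finset.mul_sum, ← Finset.sum_add_distrib]
    refine Finset.sum_congr rfl fun y _ => ?_
    rw [Finset.mul_sum, Finset.mul_sum, ← Finset.sum_add_distrib]
    refine Finset.sum_congr rfl fun x _ => ?_
    conv_lhs => rw [mul_assoc, mul_comm (avgCh V (a • q + b • q') x y), ← mul_assoc]
    conv_lhs => rw [avgCh_linear V q q' a b x y]
    rw [← avgCh_linear V q q' a b x y]
    ring_nf
    rw [avgCh_linear V q q' a b x y]
    ring
  simp only [smul_eq_mul]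
  rw [h4]
  exact add_le_add (mul_le_mul_of_nonneg_left h1 ha) (mul_le_mul_of_nonneg_left h2 hb)

end MutualInformation

section Metrics

variable {X S Y : Type} [Fintype X] [Fintype S] [Fintype Y]

/-- A decoding metric whose mean exceeds the rate under every state: the information density of a
state average that is close to the least favourable one. -/
theorem exists_decoding_metric [Nonempty X] [Nonempty S] {V : X → S → Y → ℝ} (hV : IsChannel V)
    {R R' : ℝ} (hR0 : 0 ≤ R') (hRR : R' < R) (hR : ∀ q : S → ℝ, IsPMF q → ∃ p, IsPMF p ∧ R ≤ natMI p (avgCh V q)) :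
    ∃ (p : X → ℝ) (q : S → ℝ), IsPMF p ∧ IsPMF q ∧ (∀ s, 0 < q s) ∧
      ∀ s, R' ≤ ∑ y, ∑ x, p x * V x s y *
        Real.log (avgCh V q x y / outDist p (avgCh V q) y) := by
  classical
  have hcS : (0 : ℝ) < Fintype.card S := by exact_mod_cast Fintype.card_pos
  have hcX : (0 : ℝ) < Fintype.card X := by exact_mod_cast Fintype.card_pos
  obtain ⟨η, hη, hη1, hη2⟩ : ∃ η : ℝ, 0 < η ∧ Fintype.card S * η ≤ 1 / 2 ∧
      η * (Fintype.card S * Fintype.card X) ≤ R - R' := by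
    refine ⟨min (1 / 2 / Fintype.card S) ((R - R') / (Fintype.card S * Fintype.card X)),
      lt_min (by positivity) (div_pos (by linarith) (by positivity)), ?_, ?_⟩
    · calc _ ≤ (Fintype.card S : ℝ) * (1 / 2 / Fintype.card S) :=
          mul_le_mul_of_nonneg_left (min_le_left _ _) hcS.le
        _ = _ := by field_simp
    · calc _ ≤ ((R - R') / (Fintype.card S * Fintype.card X)) * (Fintype.card S * Fintype.card X) :=
          mul_le_mul_of_nonneg_right (min_le_right _ _) (by positivity)
        _ = _ := div_mul_cancel₀ _ (by positivity)
  have hQ0 : ∀ q ∈ innerSimplex S η, ∀ s, 0 ≤ q s := fun q hq =>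
    (isPMF_of_mem_innerSimplex hη.le hq).1
  have hP0 : ∀ p ∈ innerSimplex X (0 : ℝ), ∀ s, 0 ≤ p s := fun p hp =>
    (isPMF_of_mem_innerSimplex le_rfl hp).1
  obtain ⟨q, hq, p, hp, hsad⟩ := Sion.exists_isSaddlePointOn
    (X := innerSimplex S η) (Y := innerSimplex X (0 : ℝ)) (f := fun q p => natMI p (avgCh V q))
    ⟨_, innerVertex_mem (by linarith) (Classical.arbitrary S)⟩
    (convex_innerSimplex S η) (isCompact_innerSimplex S hη.le)
    (fun p _ => (continuous_natMI_right p V).lowerSemicontinuous.lowerSemicontinuousOn _)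
    (fun p hp => (convexOn_natMI hV (hP0 p hp) (convex_innerSimplex S η) hQ0).quasiconvexOn)
    (convex_innerSimplex X 0)
    ⟨_, innerVertex_mem (by simp) (Classical.arbitrary X)⟩
    (isCompact_innerSimplex X le_rfl)
    (fun q _ => (continuous_natMI_left (avgCh V q)).upperSemicontinuous.upperSemicontinuousOn _)
    (fun q hq => (concaveOn_natMI (avgCh_nonneg hV (hQ0 q hq)) (convex_innerSimplex X 0)
      hP0).quasiconcaveOn)
  have hqP := isPMF_of_mem_innerSimplex hη.le hq
  have hpP := isPMF_of_mem_innerSimplex le_rfl hp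
  have hqpos : ∀ s, 0 < q s := fun s => hη.trans_le (hq.1 s)
  refine ⟨p, q, hpP, hqP, hqpos, ?_⟩
  have hRq : R ≤ natMI p (avgCh V q) := by
    obtain ⟨p', hp', h⟩ := hR q hqP
    exact h.trans (hsad q hq p' ⟨hp'.1, hp'.2⟩)
  have hU0 := avgCh_nonneg hV hqP.1
  have hac : ∀ x y, avgCh V q x y = 0 → ∀ s, V x s y = 0 := fun x y h s =>
    (mul_eq_zero.1 ((Finset.sum_eq_zero_iff_of_nonneg fun s _ =>
      mul_nonneg (hqP.1 s) ((hV x s).1 y)).1 h s (Finset.mem_univ s))).resolve_left (hqpos s).ne'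
  have hac' : ∀ (q' : S → ℝ) x y, avgCh V q x y = 0 → avgCh V q' x y = 0 := fun q' x y h =>
    Finset.sum_eq_zero fun s _ => by rw [hac x y h s, mul_zero]
  set D : S → ℝ := fun s => ∑ y, ∑ x, p x * V x s y *
    Real.log (avgCh V q x y / outDist p (avgCh V q) y) with hD
  have hlin : ∀ q' : S → ℝ, ∑ y, ∑ x, p x * avgCh V q' x y *
      Real.log (avgCh V q x y / outDist p (avgCh V q) y) = ∑ s, q' s * D s := by
    intro q'
    simp only [hD, Finset.mul_sum]
    rw [Finset.sum_comm (s := (Finset.univ : Finset S))]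
    refine Finset.sum_congr rfl fun y _ => ?_
    rw [Finset.sum_comm (s := (Finset.univ : Finset S))]
    refine Finset.sum_congr rfl fun x _ => ?_
    rw [avgCh, Finset.mul_sum, Finset.sum_mul]
    exact Finset.sum_congr rfl fun s _ => by ring
  have hmi : natMI p (avgCh V q) = ∑ s, q s * D s := by
    rw [natMI_eq_sum_log_div hpP.1 hU0, hlin]
  have hub : ∀ s, D s ≤ Fintype.card X := by
    intro s
    have h1 : ∀ y x, p x * V x s y * Real.log (avgCh V q x y / outDist p (avgCh V q) y)
        ≤ V x s y := by
      intro y x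
      by_cases h0 : p x * V x s y = 0
      · rw [h0, zero_mul]; exact (hV x s).1 y
      · have hpx : 0 < p x := (hpP.1 x).lt_of_ne' (left_ne_zero_of_mul h0)
        have hv : 0 < V x s y := ((hV x s).1 y).lt_of_ne' (right_ne_zero_of_mul h0)
        have hu : 0 < avgCh V q x y := (hU0 x y).lt_of_ne' fun h => hv.ne' (hac x y h s)
        have hle : p x * avgCh V q x y ≤ outDist p (avgCh V q) y :=
          Finset.single_le_sum (f := fun x => p x * avgCh V q x y)
            (fun x _ => mul_nonneg (hpP.1 x) (hU0 x y)) (Finset.mem_univ x)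
        have hP : 0 < outDist p (avgCh V q) y := (mul_pos hpx hu).trans_le hle
        have h2 : Real.log (avgCh V q x y / outDist p (avgCh V q) y) ≤ (p x)⁻¹ := by
          refine (Real.log_le_sub_one_of_pos (by positivity)).trans ?_
          have : avgCh V q x y / outDist p (avgCh V q) y ≤ (p x)⁻¹ := by
            rw [div_le_iff₀ hP, inv_mul_eq_div, le_div_iff₀ hpx]
            linarith
          linarith
        calc _ ≤ p x * V x s y * (p x)⁻¹ := mul_le_mul_of_nonneg_left h2 (by positivity)
          _ = V x s y := by field_simp
    calc D s ≤ ∑ y, ∑ x, V x s y := Finset.sum_le_sum fun y _ => Finset.sum_le_sum fun x _ => h1 y x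
      _ = Fintype.card X := by
        rw [Finset.sum_comm]
        simp_rw [(hV _ s).2]
        simp
  intro s
  set v := innerVertex η s with hv
  have hvm : v ∈ innerSimplex S η := innerVertex_mem (by linarith) s
  have hder : natMI p (avgCh V q) - ∑ s, v s * D s ≤ 0 := by
    refine nonpos_of_forall_mul_le_sq
      (c := ∑ y, ∑ x, p x * ((avgCh V v x y - avgCh V q x y) ^ 2 / avgCh V q x y)) fun t ht ht1 => ?_
    have hm := convex_innerSimplex S η hq hvm (sub_nonneg.2 ht1) ht.le (by ring)
    have h1 := hsad _ hm p hp
    have h2 := natMI_le_sum_log_div_add hpP.1 (avgCh_nonneg hV (hQ0 _ hm)) hU0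
      (fun x y h => hac' _ x y h)
    rw [hlin] at h2
    have h3 : ∑ s, ((1 - t) • q + t • v) s * D s
        = (1 - t) * natMI p (avgCh V q) + t * ∑ s, v s * D s := by
      rw [hmi]
      simp only [Pi.add_apply, Pi.smul_apply, smul_eq_mul, add_mul, Finset.sum_add_distrib,
        Finset.mul_sum, mul_assoc]
    have h4 : ∑ y, ∑ x, p x * ((avgCh V ((1 - t) • q + t • v) x y - avgCh V q x y) ^ 2
          / avgCh V q x y)
        = (∑ y, ∑ x, p x * ((avgCh V v x y - avgCh V q x y) ^ 2 / avgCh V q x y)) * t ^ 2 := by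
      rw [Finset.sum_mul]
      refine Finset.sum_congr rfl fun y _ => ?_
      rw [Finset.sum_mul]
      refine Finset.sum_congr rfl fun x _ => ?_
      rw [avgCh_linear]
      ring
    rw [h3, h4] at h2
    linarith
  rw [sum_innerVertex_mul] at hder
  have hsum : ∑ b, D b ≤ Fintype.card S * Fintype.card X := by
    calc ∑ b, D b ≤ ∑ _b : S, (Fintype.card X : ℝ) := Finset.sum_le_sum fun b _ => hub b
      _ = _ := by simp
  have h5 := mul_le_mul_of_nonneg_left hsum hη.le
  have h6 : (1 - Fintype.card S * η) * R' ≤ (1 - Fintype.card S * η) * D s := by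
    have : 0 ≤ Fintype.card S * η * R' := by positivity
    nlinarith [hη2]
  exact le_of_mul_le_mul_left h6 (by linarith)

/-- An output distribution whose divergence from every row of the channel is nearly bounded by the
capacity. -/
theorem exists_output_metric [Nonempty X] {U : X → Y → ℝ} (hU : ∀ x, IsPMF (U x))
    {C δ : ℝ} (hC : 0 ≤ C) (hδ : 0 < δ) (hUC : ∀ p, IsPMF p → natMI p U ≤ C) :
    ∃ Q : Y → ℝ, IsPMF Q ∧ (∀ x y, Q y = 0 → U x y = 0) ∧
      ∀ x, ∑ y, U x y * Real.log (U x y / Q y) ≤ C + δ := by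
  classical
  have hcX : (0 : ℝ) < Fintype.card X := by exact_mod_cast Fintype.card_pos
  set η : ℝ := δ / (2 * (C + δ)) / Fintype.card X with hη
  have hCd : 0 < C + δ := by linarith
  have hη0 : 0 < η := by positivity
  have hcη : Fintype.card X * η = δ / (2 * (C + δ)) := by rw [hη]; field_simp
  have hcη1 : Fintype.card X * η ≤ 1 / 2 := by
    rw [hcη, div_le_div_iff₀ (by positivity) (by norm_num)]; linarith
  obtain ⟨p, hp, hmax⟩ := (isCompact_innerSimplex X hη0.le).exists_isMaxOn
    ⟨_, innerVertex_mem (by linarith) (Classical.arbitrary X)⟩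
    (continuous_natMI_left U).continuousOn
  have hpP := isPMF_of_mem_innerSimplex hη0.le hp
  have hU0 : ∀ x y, 0 ≤ U x y := fun x => (hU x).1
  have hppos : ∀ x, 0 < p x := fun x => hη0.trans_le (hp.1 x)
  have hac : ∀ x y, outDist p U y = 0 → U x y = 0 := fun x y h =>
    (mul_eq_zero.1 (mul_eq_zero_of_outDist_eq_zero hpP.1 hU0 h x)).resolve_left (hppos x).ne'
  have hQ : IsPMF (outDist p U) := ⟨outDist_nonneg hpP.1 hU0, sum_outDist hpP hU⟩
  refine ⟨outDist p U, hQ, hac, fun x => ?_⟩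
  set D : X → ℝ := fun x => ∑ y, U x y * Real.log (U x y / outDist p U y) with hD
  have hlin : ∀ p' : X → ℝ, ∑ y, ∑ x, p' x * U x y * Real.log (U x y / outDist p U y)
      = ∑ x, p' x * D x := by
    intro p'
    rw [Finset.sum_comm]
    simp only [hD, Finset.mul_sum, mul_assoc]
  have hDn : ∀ x, 0 ≤ D x := by
    intro x
    have : ∑ y, (U x y - outDist p U y) ≤ D x :=
      Finset.sum_le_sum fun y _ => mul_log_div_ge (hU0 x y) (hQ.1 y) (hac x y)
    rwa [Finset.sum_sub_distrib, (hU x).2, hQ.2, sub_self] at this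
  have hmi : natMI p U = ∑ x, p x * D x := by rw [natMI_eq_sum_log_div hpP.1 hU0, hlin]
  set v := innerVertex η x with hv
  have hvm : v ∈ innerSimplex X η := innerVertex_mem (by linarith) x
  have hder : ∑ x, v x * D x - natMI p U ≤ 0 := by
    refine nonpos_of_forall_mul_le_sq
      (c := ∑ y, (outDist v U y - outDist p U y) ^ 2 / outDist p U y) fun t ht ht1 => ?_
    have hm := convex_innerSimplex X η hp hvm (sub_nonneg.2 ht1) ht.le (by ring)
    have hmP := isPMF_of_mem_innerSimplex hη0.le hm
    have h1 : natMI _ U ≤ natMI p U := hmax hm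
    have h2 := sum_log_div_sub_le_natMI hmP.1 hpP.1 hU0 hac
    rw [hlin, sum_outDist hmP hU, sum_outDist hpP hU, sub_self, sub_zero] at h2
    have h3 : ∑ s, ((1 - t) • p + t • v) s * D s
        = (1 - t) * natMI p U + t * ∑ s, v s * D s := by
      rw [hmi]
      simp only [Pi.add_apply, Pi.smul_apply, smul_eq_mul, add_mul, Finset.sum_add_distrib,
        Finset.mul_sum, mul_assoc]
    have h4 : ∑ y, (outDist ((1 - t) • p + t • v) U y - outDist p U y) ^ 2 / outDist p U y
        = (∑ y, (outDist v U y - outDist p U y) ^ 2 / outDist p U y) * t ^ 2 := by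
      rw [Finset.sum_mul]
      refine Finset.sum_congr rfl fun y _ => ?_
      rw [outDist_linear]
      ring
    rw [h3, h4] at h2
    linarith
  rw [sum_innerVertex_mul] at hder
  have h5 : 0 ≤ η * ∑ b, D b := mul_nonneg hη0.le (Finset.sum_nonneg fun b _ => hDn b)
  have h6 := hUC p hpP
  have h7 : (1 - Fintype.card X * η) * D x ≤ C := by linarith
  have h8 : (1 - Fintype.card X * η) * (C + δ) = C + δ / 2 := by
    rw [hcη]; field_simp; ring
  by_contra! hcon
  have h9 : (1 - Fintype.card X * η) * (C + δ) ≤ (1 - Fintype.card X * η) * D x :=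
    mul_le_mul_of_nonneg_left hcon.le (by linarith)
  linarith

end Metrics

section RandomCoding

variable {X S Y : Type}

/-- Average error probability of the block code `(c, d)` over the channel `V` when the state
sequence is `s`. -/
def blockErr [Fintype Y] {ι μ : Type} [Fintype ι] [DecidableEq ι] [Fintype μ] [DecidableEq μ]
    (V : X → S → Y → ℝ) (c : μ → ι → X) (d : (ι → Y) → μ) (s : ι → S) : ℝ :=
  (Fintype.card μ : ℝ)⁻¹ * ∑ m, ∑ y, if d y = m then 0 else ∏ i, V (c m i) (s i) (y i)

theorem isPMF_pi {ι A : Type} [Fintype ι] [DecidableEq ι] [Fintype A] {w : ι → A → ℝ}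
    (hw : ∀ i, IsPMF (w i)) : IsPMF fun z : ι → A => ∏ i, w i (z i) :=
  ⟨fun z => Finset.prod_nonneg fun i _ => (hw i).1 (z i), by
    rw [sum_prod_apply]; simp [(hw _).2]⟩

theorem blockErr_nonneg [Fintype Y] {ι μ : Type} [Fintype ι] [DecidableEq ι] [Fintype μ]
    [DecidableEq μ] {V : X → S → Y → ℝ} (hV : IsChannel V) (c : μ → ι → X) (d : (ι → Y) → μ)
    (s : ι → S) : 0 ≤ blockErr V c d s := by
  refine mul_nonneg (by positivity) (Finset.sum_nonneg fun m _ => Finset.sum_nonneg fun y _ => ?_)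
  split_ifs
  · exact le_rfl
  · exact (isPMF_pi fun i => hV (c m i) (s i)).1 y

theorem blockErr_le_one [Fintype Y] {ι μ : Type} [Fintype ι] [DecidableEq ι] [Fintype μ]
    [DecidableEq μ] {V : X → S → Y → ℝ} (hV : IsChannel V) (c : μ → ι → X) (d : (ι → Y) → μ)
    (s : ι → S) : blockErr V c d s ≤ 1 := by
  have h : ∀ m, (∑ y, if d y = m then 0 else ∏ i, V (c m i) (s i) (y i)) ≤ 1 := by
    intro m
    rw [← (isPMF_pi fun i => hV (c m i) (s i)).2]
    refine Finset.sum_le_sum fun y _ => ?_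
    split_ifs
    · exact (isPMF_pi fun i => hV (c m i) (s i)).1 y
    · exact le_rfl
  unfold blockErr
  calc _ ≤ (Fintype.card μ : ℝ)⁻¹ * ∑ m : μ, (1 : ℝ) := by
        gcongr with m
        exact h m
    _ ≤ 1 := by
        simp only [Finset.sum_const, Finset.card_univ, nsmul_eq_mul, mul_one]
        exact inv_mul_le_one

/-- Two distinct coordinates of an i.i.d. family are independent. -/
theorem sum_prod_mul_mul {μ A : Type} [Fintype μ] [DecidableEq μ] [Fintype A] {P : A → ℝ}
    (hP : ∑ a, P a = 1) (g h : A → ℝ) {m m' : μ} (hm : m ≠ m') :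
    ∑ c : μ → A, (∏ k, P (c k)) * (g (c m) * h (c m')) = (∑ a, P a * g a) * ∑ a, P a * h a := by
  have h1 : ∀ c : μ → A, (∏ k, P (c k)) * (g (c m) * h (c m'))
      = ∏ k, (P (c k) * ((if k = m then g (c k) else 1) * if k = m' then h (c k) else 1)) := by
    intro c
    rw [Finset.prod_mul_distrib, Finset.prod_mul_distrib]
    simp
  simp_rw [h1]
  rw [sum_prod_apply fun k a => P a * ((if k = m then g a else 1) * if k = m' then h a else 1)]
  rw [← Finset.mul_prod_erase _ _ (Finset.mem_univ m),
    ← Finset.mul_prod_erase _ _ (Finset.mem_erase.2 ⟨hm.symm, Finset.mem_univ m'⟩),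
    Finset.prod_eq_one]
  · simp [hm, hm.symm]
  · intro k hk
    simp only [Finset.mem_erase, Finset.mem_univ, and_true] at hk
    simp [hk.1, hk.2, hP]

theorem sum_prod_mul_single {μ A : Type} [Fintype μ] [DecidableEq μ] [Fintype A] {P : A → ℝ}
    (hP : ∑ a, P a = 1) (g : A → ℝ) (m : μ) :
    ∑ c : μ → A, (∏ k, P (c k)) * g (c m) = ∑ a, P a * g a := by
  have h1 : ∀ c : μ → A, (∏ k, P (c k)) * g (c m)
      = ∏ k, (P (c k) * (if k = m then g (c k) else 1)) := by
    intro c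
    rw [Finset.prod_mul_distrib]
    simp
  simp_rw [h1]
  rw [sum_prod_apply fun k a => P a * (if k = m then g a else 1),
    ← Finset.mul_prod_erase _ _ (Finset.mem_univ m), Finset.prod_eq_one]
  · simp
  · intro k hk
    simp only [Finset.mem_erase, Finset.mem_univ, and_true] at hk
    simp [hk, hP]

/-- The decoder choosing the only message whose metric exceeds the threshold. -/
def thresholdDecoder {ι μ : Type} [Fintype ι] [Nonempty μ] (r : X → Y → ℝ) (τ : ℝ)
    (c : μ → ι → X) (y : ι → Y) : μ :=
  Classical.epsilon fun m => τ < ∏ i, r (c m i) (y i)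

theorem thresholdDecoder_indicator_le {ι μ : Type} [Fintype ι] [Fintype μ] [DecidableEq μ]
    [Nonempty μ] (r : X → Y → ℝ) (τ : ℝ) (c : μ → ι → X) (y : ι → Y) (m : μ) :
    (if thresholdDecoder r τ c y = m then (0 : ℝ) else 1)
      ≤ (if ∏ i, r (c m i) (y i) ≤ τ then 1 else 0)
        + ∑ m' ∈ Finset.univ.erase m, if τ < ∏ i, r (c m' i) (y i) then 1 else 0 := by
  have h0 : 0 ≤ ∑ m' ∈ Finset.univ.erase m, if τ < ∏ i, r (c m' i) (y i) then (1 : ℝ) else 0 :=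
    Finset.sum_nonneg fun m' _ => by split_ifs <;> norm_num
  by_cases h1 : ∏ i, r (c m i) (y i) ≤ τ
  · rw [if_pos h1]
    split_ifs <;> linarith
  rw [if_neg h1, zero_add]
  split_ifs with h2
  · exact h0
  have h3 : τ < ∏ i, r (c (thresholdDecoder r τ c y) i) (y i) :=
    Classical.epsilon_spec (p := fun m => τ < ∏ i, r (c m i) (y i)) ⟨m, not_le.1 h1⟩
  calc (1 : ℝ) = if τ < ∏ i, r (c (thresholdDecoder r τ c y) i) (y i) then 1 else 0 := by
        rw [if_pos h3]
    _ ≤ _ := Finset.single_le_sum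
        (f := fun m' => if τ < ∏ i, r (c m' i) (y i) then (1 : ℝ) else 0)
        (fun m' _ => by split_ifs <;> norm_num)
        (Finset.mem_erase.2 ⟨h2, Finset.mem_univ _⟩)

theorem sum_indicator_metric_le [Fintype X] {ι : Type} [Fintype ι] [DecidableEq ι] {p : X → ℝ}
    (hp : ∀ x, 0 ≤ p x) {r : X → Y → ℝ} (hr : ∀ x y, 0 ≤ r x y)
    (hr1 : ∀ y, ∑ x, p x * r x y ≤ 1) {τ : ℝ} (hτ : 0 < τ) (y : ι → Y) :
    ∑ x : ι → X, (∏ i, p (x i)) * (if τ < ∏ i, r (x i) (y i) then 1 else 0) ≤ τ⁻¹ := by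
  calc _ ≤ ∑ x : ι → X, τ⁻¹ * ∏ i, (p (x i) * r (x i) (y i)) := by
        refine Finset.sum_le_sum fun x _ => ?_
        have h1 : 0 ≤ ∏ i, p (x i) := Finset.prod_nonneg fun i _ => hp _
        have h2 : 0 ≤ ∏ i, r (x i) (y i) := Finset.prod_nonneg fun i _ => hr _ _
        rw [Finset.prod_mul_distrib, mul_left_comm]
        refine mul_le_mul_of_nonneg_left ?_ h1
        split_ifs with h
        · rw [inv_mul_eq_div, one_le_div hτ]
          exact h.le
        · positivity
    _ = τ⁻¹ * ∏ i, ∑ x, p x * r x (y i) := by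
        rw [← Finset.mul_sum, sum_prod_apply fun i x => p x * r x (y i)]
    _ ≤ τ⁻¹ * 1 := by
        gcongr
        exact Finset.prod_le_one
          (fun i _ => Finset.sum_nonneg fun x _ => mul_nonneg (hp x) (hr _ _)) fun i _ => hr1 _
    _ = τ⁻¹ := mul_one _

theorem sum_small_metric_le [Fintype X] [Fintype Y] {ι : Type} [Fintype ι] [DecidableEq ι]
    {V : X → S → Y → ℝ} (hV : IsChannel V) {p : X → ℝ} (hp : IsPMF p) {r : X → Y → ℝ}
    (hr0 : ∀ x s y, 0 < p x → 0 < V x s y → 0 < r x y) {R' : ℝ}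
    (hm : ∀ s, R' ≤ ∑ y, ∑ x, p x * V x s y * Real.log (r x y))
    {B l γ : ℝ} (hl : 0 ≤ l) (hB : ∀ x y, |Real.log (r x y)| ≤ B) (hlB : l * B ≤ 1) (s : ι → S) :
    ∑ x : ι → X, (∏ i, p (x i)) * ∑ y : ι → Y, (∏ i, V (x i) (s i) (y i)) *
        (if ∏ i, r (x i) (y i) ≤ Real.exp (Fintype.card ι * γ) then 1 else 0)
      ≤ Real.exp (Fintype.card ι * (l ^ 2 * B ^ 2 - l * (R' - γ))) := by
  have hC := sum_prod_mul_exp_le (fun i (a : X × Y) => p a.1 * V a.1 (s i) a.2)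
    (fun i a => Real.log (r a.1 a.2)) (fun i a => mul_nonneg (hp.1 _) ((hV _ _).1 _))
    (fun i => by
      rw [Fintype.sum_prod_type]
      simp_rw [← Finset.mul_sum, (hV _ _).2, mul_one, hp.2]) hl (fun i a => hB _ _) hlB
    (m := R') (fun i => by
      rw [Fintype.sum_prod_type, Finset.sum_comm]
      exact hm (s i))
  have hE : Real.exp (Fintype.card ι * (l ^ 2 * B ^ 2 - l * (R' - γ)))
      = Real.exp (l * (Fintype.card ι * γ))
        * Real.exp (Fintype.card ι * (l ^ 2 * B ^ 2 - l * R')) := by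
    rw [← Real.exp_add]
    ring_nf
  rw [hE]
  refine le_trans ?_ (mul_le_mul_of_nonneg_left hC (Real.exp_pos _).le)
  rw [← (Equiv.arrowProdEquivProdArrow ι (fun _ => X) (fun _ => Y)).symm.sum_comp,
    Fintype.sum_prod_type, Finset.mul_sum]
  refine Finset.sum_le_sum fun x _ => ?_
  rw [Finset.mul_sum, Finset.mul_sum]
  refine Finset.sum_le_sum fun y _ => ?_
  simp only [Equiv.arrowProdEquivProdArrow, Equiv.coe_fn_symm_mk]
  rw [Finset.prod_mul_distrib, ← mul_assoc, mul_left_comm]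
  have hP : 0 ≤ (∏ i, p (x i)) * ∏ i, V (x i) (s i) (y i) :=
    mul_nonneg (Finset.prod_nonneg fun i _ => hp.1 _)
      (Finset.prod_nonneg fun i _ => (hV _ _).1 _)
  refine (hP.eq_or_lt).elim (fun h => by rw [← h]; simp) fun h => ?_
  refine mul_le_mul_of_nonneg_left ?_ hP
  rw [← Real.exp_add]
  split_ifs with h1
  · rw [Real.one_le_exp_iff]
    have hpos : ∀ i, 0 < r (x i) (y i) := by
      intro i
      refine hr0 _ (s i) _ ((hp.1 _).lt_of_ne' fun h0 => ?_) (((hV _ _).1 _).lt_of_ne' fun h0 => ?_)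
      · rw [Finset.prod_eq_zero (Finset.mem_univ i) h0, zero_mul] at h
        exact h.ne rfl
      · rw [Finset.prod_eq_zero (f := fun i => V (x i) (s i) (y i)) (Finset.mem_univ i) h0,
          mul_zero] at h
        exact h.ne rfl
    have h2 : ∑ i, Real.log (r (x i) (y i)) ≤ Fintype.card ι * γ := by
      rw [← Real.log_prod fun i _ => (hpos i).ne']
      exact (Real.log_le_iff_le_exp (Finset.prod_pos fun i _ => hpos i)).2 h1
    nlinarith
  · positivity

/-- The ensemble average of the error probability of threshold decoding. -/
theorem sum_blockErr_thresholdDecoder_le [Fintype X] [Fintype Y] {ι μ : Type} [Fintype ι]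
    [DecidableEq ι] [Fintype μ] [DecidableEq μ] [Nonempty μ]
    {V : X → S → Y → ℝ} (hV : IsChannel V) {p : X → ℝ} (hp : IsPMF p) {r : X → Y → ℝ}
    (hr : ∀ x y, 0 ≤ r x y) (hr0 : ∀ x s y, 0 < p x → 0 < V x s y → 0 < r x y)
    (hr1 : ∀ y, ∑ x, p x * r x y ≤ 1) {R' : ℝ}
    (hm : ∀ s, R' ≤ ∑ y, ∑ x, p x * V x s y * Real.log (r x y))
    {B l γ : ℝ} (hl : 0 ≤ l) (hB : ∀ x y, |Real.log (r x y)| ≤ B) (hlB : l * B ≤ 1) (s : ι → S) :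
    ∑ c : μ → ι → X, (∏ m, ∏ i, p (c m i)) *
        blockErr V c (thresholdDecoder r (Real.exp (Fintype.card ι * γ)) c) s
      ≤ Real.exp (Fintype.card ι * (l ^ 2 * B ^ 2 - l * (R' - γ)))
        + Fintype.card μ * Real.exp (-(Fintype.card ι * γ)) := by
  set τ := Real.exp (Fintype.card ι * γ) with hτ
  have hτ0 : 0 < τ := Real.exp_pos _
  have hτi : Real.exp (-(Fintype.card ι * γ)) = τ⁻¹ := Real.exp_neg _
  rw [hτi]
  set P : (ι → X) → ℝ := fun x => ∏ i, p (x i) with hPdef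
  have hP : IsPMF P := isPMF_pi fun _ => hp
  set miss : ℝ := Real.exp (Fintype.card ι * (l ^ 2 * B ^ 2 - l * (R' - γ))) with hmiss
  have hkey : ∀ m : μ, ∑ c : μ → ι → X, (∏ k, P (c k)) *
      (∑ y, if thresholdDecoder r τ c y = m then 0 else ∏ i, V (c m i) (s i) (y i))
      ≤ miss + Fintype.card μ * τ⁻¹ := by
    intro m
    set Vn : (ι → X) → (ι → Y) → ℝ := fun x y => ∏ i, V (x i) (s i) (y i) with hVn
    have hVP : ∀ x, IsPMF (Vn x) := fun x => isPMF_pi fun i => hV (x i) (s i)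
    have h1 : ∀ c : μ → ι → X,
        (∑ y, if thresholdDecoder r τ c y = m then 0 else ∏ i, V (c m i) (s i) (y i))
        ≤ (∑ y, Vn (c m) y * (if ∏ i, r (c m i) (y i) ≤ τ then 1 else 0))
          + ∑ m' ∈ Finset.univ.erase m, ∑ y, Vn (c m) y *
            (if τ < ∏ i, r (c m' i) (y i) then 1 else 0) := by
      intro c
      rw [Finset.sum_comm, ← Finset.sum_add_distrib]
      refine Finset.sum_le_sum fun y _ => ?_
      rw [← Finset.mul_sum, ← mul_add]
      calc _ = Vn (c m) y * (if thresholdDecoder r τ c y = m then (0 : ℝ) else 1) := by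
            split_ifs <;> simp [hVn]
        _ ≤ _ := mul_le_mul_of_nonneg_left
            (thresholdDecoder_indicator_le r τ c y m) ((hVP _).1 y)
    have hPc : ∀ c : μ → ι → X, 0 ≤ ∏ k, P (c k) :=
      fun c => Finset.prod_nonneg fun k _ => hP.1 _
    calc _ ≤ ∑ c : μ → ι → X, (∏ k, P (c k)) *
          ((∑ y, Vn (c m) y * (if ∏ i, r (c m i) (y i) ≤ τ then 1 else 0))
          + ∑ m' ∈ Finset.univ.erase m, ∑ y, Vn (c m) y *
            (if τ < ∏ i, r (c m' i) (y i) then 1 else 0)) :=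
          Finset.sum_le_sum fun c _ => mul_le_mul_of_nonneg_left (h1 c) (hPc c)
      _ = (∑ c : μ → ι → X, (∏ k, P (c k)) *
            (∑ y, Vn (c m) y * (if ∏ i, r (c m i) (y i) ≤ τ then 1 else 0)))
          + ∑ m' ∈ Finset.univ.erase m, ∑ y, ∑ c : μ → ι → X, (∏ k, P (c k)) * (Vn (c m) y *
            (if τ < ∏ i, r (c m' i) (y i) then 1 else 0)) := by
          simp_rw [mul_add, Finset.sum_add_distrib]
          congr 1
          simp_rw [Finset.mul_sum]
          rw [Finset.sum_comm]
          exact Finset.sum_congr rfl fun m' _ => Finset.sum_comm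
      _ ≤ miss + ∑ m' ∈ Finset.univ.erase m, τ⁻¹ := by
          refine add_le_add ?_ (Finset.sum_le_sum fun m' hm' => ?_)
          · rw [sum_prod_mul_single hP.2
              fun x => ∑ y, Vn x y * (if ∏ i, r (x i) (y i) ≤ τ then 1 else 0)]
            exact sum_small_metric_le hV hp hr0 hm hl hB hlB s
          · have hne : m ≠ m' := (Finset.mem_erase.1 hm').1.symm
            calc _ = ∑ y, (∑ x, P x * Vn x y) *
                  ∑ x, P x * (if τ < ∏ i, r (x i) (y i) then 1 else 0) :=
                  Finset.sum_congr rfl fun y _ =>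
                    sum_prod_mul_mul hP.2 (fun x => Vn x y)
                      (fun x => if τ < ∏ i, r (x i) (y i) then 1 else 0) hne
              _ ≤ ∑ y, (∑ x, P x * Vn x y) * τ⁻¹ := by
                  refine Finset.sum_le_sum fun y _ => mul_le_mul_of_nonneg_left ?_
                    (Finset.sum_nonneg fun x _ => mul_nonneg (hP.1 x) ((hVP x).1 y))
                  exact sum_indicator_metric_le hp.1 hr hr1 hτ0 y
              _ = τ⁻¹ := by
                  rw [← Finset.sum_mul, Finset.sum_comm]
                  simp_rw [← Finset.mul_sum, (hVP _).2, mul_one, hP.2, one_mul]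
      _ ≤ miss + Fintype.card μ * τ⁻¹ := by
          rw [Finset.sum_const, nsmul_eq_mul]
          gcongr
          exact Finset.card_le_univ _
  have hcard : (Fintype.card μ : ℝ) ≠ 0 := by simp
  calc _ = (Fintype.card μ : ℝ)⁻¹ * ∑ m : μ, ∑ c : μ → ι → X, (∏ k, P (c k)) *
      (∑ y, if thresholdDecoder r τ c y = m then 0 else ∏ i, V (c m i) (s i) (y i)) := by
        rw [Finset.sum_comm, Finset.mul_sum]
        refine Finset.sum_congr rfl fun c _ => ?_
        rw [← Finset.mul_sum, mul_left_comm]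
        rfl
    _ ≤ (Fintype.card μ : ℝ)⁻¹ * ∑ m : μ, (miss + Fintype.card μ * τ⁻¹) := by
        gcongr with m
        exact hkey m
    _ = _ := by
        rw [Finset.sum_const, nsmul_eq_mul, Finset.card_univ, inv_mul_cancel_left₀ hcard]

/-- A random choice of finitely many samples is simultaneously good for all states when the
ensemble average is exponentially small. -/
theorem exists_sample_of_sum_le {Ω T : Type} [Fintype Ω] [Fintype T] {P : Ω → ℝ}
    (hP : IsPMF P) {e : Ω → T → ℝ} (he0 : ∀ ω s, 0 ≤ e ω s) (he1 : ∀ ω s, e ω s ≤ 1)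
    {α θ ε : ℝ} {K : ℕ} (hθ : 0 ≤ θ) (hα : ∀ s, ∑ ω, P ω * e ω s ≤ α)
    (h : Fintype.card T * (1 + Real.exp θ * α) ^ K < Real.exp (θ * (K * ε))) :
    ∃ cc : Fin K → Ω, ∀ s, (K : ℝ)⁻¹ * ∑ k, e (cc k) s ≤ ε := by
  by_contra! hcon
  have hb : ∀ s, ∑ cc : Fin K → Ω, (∏ k, P (cc k)) * Real.exp (θ * ∑ k, e (cc k) s)
      ≤ (1 + Real.exp θ * α) ^ K := by
    intro s
    have h1 : ∀ cc : Fin K → Ω, (∏ k, P (cc k)) * Real.exp (θ * ∑ k, e (cc k) s)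
        = ∏ k, (P (cc k) * Real.exp (θ * e (cc k) s)) := by
      intro cc
      rw [Finset.prod_mul_distrib, ← Real.exp_sum, Finset.mul_sum]
    simp_rw [h1]
    rw [sum_prod_apply fun (_ : Fin K) ω => P ω * Real.exp (θ * e ω s), Finset.prod_const,
      Finset.card_univ, Fintype.card_fin]
    refine pow_le_pow_left₀ (Finset.sum_nonneg fun ω _ => mul_nonneg (hP.1 ω) (Real.exp_pos _).le)
      ?_ K
    calc _ ≤ ∑ ω, (P ω + Real.exp θ * (P ω * e ω s)) := by
          refine Finset.sum_le_sum fun ω _ => ?_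
          have h2 : Real.exp (θ * e ω s) ≤ 1 + e ω s * Real.exp θ := by
            have := convexOn_exp.2 (Set.mem_univ (0 : ℝ)) (Set.mem_univ θ)
              (sub_nonneg.2 (he1 ω s)) (he0 ω s) (by ring)
            simp only [smul_eq_mul, mul_zero, zero_add, Real.exp_zero, mul_one] at this
            rw [mul_comm θ]
            linarith [he0 ω s]
          nlinarith [hP.1 ω, mul_le_mul_of_nonneg_left h2 (hP.1 ω)]
      _ ≤ _ := by
          rw [Finset.sum_add_distrib, ← Finset.mul_sum, hP.2]
          gcongr
          exact hα s
  have hK : 0 < (K : ℝ) := by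
    rcases Nat.eq_zero_or_pos K with rfl | hK
    · obtain ⟨s, -⟩ := hcon fun k => k.elim0
      have := Fintype.card_pos_iff.2 ⟨s⟩
      simp at h
      lia
    · exact_mod_cast hK
  have hPP : IsPMF fun cc : Fin K → Ω => ∏ k, P (cc k) := isPMF_pi fun _ => hP
  have hlow : Real.exp (θ * (K * ε)) ≤
      ∑ s, ∑ cc : Fin K → Ω, (∏ k, P (cc k)) * Real.exp (θ * ∑ k, e (cc k) s) := by
    rw [Finset.sum_comm, ← one_mul (Real.exp _), ← hPP.2, Finset.sum_mul]
    refine Finset.sum_le_sum fun cc _ => ?_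
    rw [← Finset.mul_sum]
    refine mul_le_mul_of_nonneg_left ?_ (hPP.1 cc)
    obtain ⟨s, hs⟩ := hcon cc
    calc _ ≤ Real.exp (θ * ∑ k, e (cc k) s) := by
          rw [Real.exp_le_exp]
          refine mul_le_mul_of_nonneg_left ?_ hθ
          rw [inv_mul_eq_div, lt_div_iff₀ hK] at hs
          linarith
      _ ≤ _ := Finset.single_le_sum (f := fun s => Real.exp (θ * ∑ k, e (cc k) s))
          (fun _ _ => (Real.exp_pos _).le) (Finset.mem_univ s)
  have := hlow.trans (Finset.sum_le_sum fun s _ => hb s)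
  rw [Finset.sum_const, nsmul_eq_mul, Finset.card_univ] at this
  linarith

/-- Finitely many equiprobable codebooks suffice for reliable communication. -/
theorem exists_correlated_code [Fintype X] [Fintype S] [Fintype Y] [Nonempty X] [Nonempty S]
    {V : X → S → Y → ℝ} (hV : IsChannel V) {R ρ ε : ℝ} (hR0 : 0 < R) (hρ : ρ < R) (hε : 0 < ε)
    (hR : ∀ q, IsPMF q → ∃ p, IsPMF p ∧ R ≤ natMI p (avgCh V q)) :
    ∃ K₁ : ℕ, ∀ K ≥ K₁, ∃ N : ℕ, ∀ n ≥ N, ∀ M : ℕ, 1 ≤ M → (M : ℝ) ≤ Real.exp (n * ρ) →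
      ∃ (cc : Fin K → Fin M → Fin n → X) (dd : Fin K → (Fin n → Y) → Fin M),
        ∀ s, (K : ℝ)⁻¹ * ∑ k, blockErr V (cc k) (dd k) s ≤ ε := by
  obtain ⟨R', hR'0, hρR', hR'R⟩ : ∃ R', 0 ≤ R' ∧ ρ < R' ∧ R' < R := by
    obtain ⟨R', h1, h2⟩ := exists_between (max_lt hR0 hρ)
    exact ⟨R', (le_max_left _ _).trans h1.le, (le_max_right _ _).trans_lt h1, h2⟩
  obtain ⟨p, q, hp, hq, hq0, hm⟩ := exists_decoding_metric hV hR'0 hR'R hR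
  set U := avgCh V q with hU
  have hU0 : ∀ x y, 0 ≤ U x y := fun x y => avgCh_nonneg hV hq.1 x y
  set r : X → Y → ℝ := fun x y => U x y / outDist p U y with hr
  have hr0 : ∀ x y, 0 ≤ r x y := fun x y => div_nonneg (hU0 x y) (outDist_nonneg hp.1 hU0 y)
  have hrpos : ∀ x s y, 0 < p x → 0 < V x s y → 0 < r x y := by
    intro x s y hx hv
    have h1 : 0 < U x y := lt_of_lt_of_le (mul_pos (hq0 s) hv)
      (Finset.single_le_sum (f := fun s => q s * V x s y)
        (fun s _ => mul_nonneg (hq.1 s) ((hV x s).1 y)) (Finset.mem_univ s))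
    refine div_pos h1 ((outDist_nonneg hp.1 hU0 y).lt_of_ne' fun h0 => ?_)
    exact (mul_pos hx h1).ne' (mul_eq_zero_of_outDist_eq_zero hp.1 hU0 h0 x)
  have hr1 : ∀ y, ∑ x, p x * r x y ≤ 1 := by
    intro y
    simp only [hr, ← mul_div_assoc]
    rw [← Finset.sum_div]
    exact div_self_le_one (outDist p U y)
  obtain ⟨B, hB1, hB⟩ : ∃ B : ℝ, 1 ≤ B ∧ ∀ x y, |Real.log (r x y)| ≤ B := by
    refine ⟨1 + ∑ a : X × Y, |Real.log (r a.1 a.2)|, ?_, fun x y => ?_⟩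
    · linarith [Finset.sum_nonneg fun (a : X × Y) (_ : a ∈ Finset.univ) =>
        abs_nonneg (Real.log (r a.1 a.2))]
    · have := Finset.single_le_sum (f := fun a : X × Y => |Real.log (r a.1 a.2)|)
        (fun a _ => abs_nonneg _) (Finset.mem_univ (x, y))
      linarith
  set δ := (R' - ρ) / 2 with hδ
  have hδ0 : 0 < δ := by rw [hδ]; linarith
  set l := min (1 / B) (δ / (2 * B ^ 2)) with hl
  have hB0 : 0 < B := by linarith
  have hl0 : 0 < l := lt_min (by positivity) (by positivity)
  have hlB : l * B ≤ 1 := by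
    have := min_le_left (1 / B) (δ / (2 * B ^ 2))
    rw [← hl, le_div_iff₀ hB0] at this
    exact this
  have hlB2 : l * B ^ 2 ≤ δ / 2 := by
    have := min_le_right (1 / B) (δ / (2 * B ^ 2))
    rw [← hl, le_div_iff₀ (by positivity)] at this
    linarith
  set κ := min (l * δ / 2) δ with hκ
  have hκ0 : 0 < κ := lt_min (by positivity) hδ0
  obtain ⟨K₁, hK₁⟩ := exists_nat_ge ((Real.log (Fintype.card S) + 1) / (κ * ε))
  refine ⟨K₁, fun K hK => ?_⟩
  have hKε : Real.log (Fintype.card S) + 1 ≤ κ * (K * ε) := by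
    have : (Real.log (Fintype.card S) + 1) / (κ * ε) ≤ K :=
      hK₁.trans (by exact_mod_cast hK)
    rw [div_le_iff₀ (by positivity)] at this
    linarith
  obtain ⟨N, hN⟩ := exists_nat_gt (K * Real.log 3)
  refine ⟨N, fun n hn M hM hMρ => ?_⟩
  have : Nonempty (Fin M) := ⟨⟨0, hM⟩⟩
  set τ := Real.exp (Fintype.card (Fin n) * (R' - δ)) with hτ
  have hα : ∀ s : Fin n → S, ∑ c : Fin M → Fin n → X, (∏ m, ∏ i, p (c m i)) *
      blockErr V c (thresholdDecoder r τ c) s ≤ 2 * Real.exp (-(n * κ)) := by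
    intro s
    refine (sum_blockErr_thresholdDecoder_le hV hp hr0 hrpos hr1 hm hl0.le hB hlB s).trans ?_
    rw [two_mul, Fintype.card_fin, Fintype.card_fin]
    refine add_le_add (Real.exp_le_exp.2 ?_) ?_
    · rw [← mul_neg]
      refine mul_le_mul_of_nonneg_left ?_ (Nat.cast_nonneg n)
      have h1 : κ ≤ l * δ / 2 := min_le_left _ _
      nlinarith [mul_le_mul_of_nonneg_left hlB2 hl0.le]
    · calc _ ≤ Real.exp (n * ρ) * Real.exp (-(n * (R' - δ))) := by gcongr
        _ ≤ _ := by
          rw [← Real.exp_add, Real.exp_le_exp]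
          have h1 : κ ≤ δ := min_le_right _ _
          have h2 : (n : ℝ) * κ ≤ n * δ := mul_le_mul_of_nonneg_left h1 (Nat.cast_nonneg n)
          have h3 : R' = ρ + 2 * δ := by rw [hδ]; ring
          rw [h3]
          linarith
  obtain ⟨cc, hcc⟩ := exists_sample_of_sum_le (K := K) (ε := ε) (θ := n * κ)
    (P := fun c : Fin M → Fin n → X => ∏ m, ∏ i, p (c m i))
    (isPMF_pi fun _ => isPMF_pi fun _ => hp)
    (fun c s => blockErr_nonneg hV c (thresholdDecoder r τ c) s)
    (fun c s => blockErr_le_one hV c (thresholdDecoder r τ c) s) (by positivity) hα (by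
      have h1 : Real.exp (n * κ) * (2 * Real.exp (-(n * κ))) = 2 := by
        rw [mul_left_comm, ← Real.exp_add]
        simp
      have h2 : (0 : ℝ) < Fintype.card S := by exact_mod_cast Fintype.card_pos
      have hn' : (K : ℝ) * Real.log 3 < n := hN.trans_le (by exact_mod_cast hn)
      rw [h1, Fintype.card_fun, Fintype.card_fin, Nat.cast_pow]
      norm_num only
      rw [← Real.exp_log (pow_pos h2 n), ← Real.exp_log (pow_pos (show (0 : ℝ) < 3 by norm_num) K),
        ← Real.exp_add, Real.exp_lt_exp, Real.log_pow, Real.log_pow]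
      have h3 := mul_le_mul_of_nonneg_left hKε (Nat.cast_nonneg (α := ℝ) n)
      rw [← mul_assoc] at h3
      linarith)
  exact ⟨cc, fun k => thresholdDecoder r τ (cc k), hcc⟩

end RandomCoding

section PrefixCode

variable {X S Y : Type} [Fintype X] [Fintype S] [Fintype Y]

/-- Quantitative form of non-symmetrizability, with two different symmetrizing families. -/
theorem exists_symmetrizing_gap {V : X → S → Y → ℝ} (hns : ¬ Symmetrizable V) :
    ∃ ζ > 0, ∀ J J' : X → S → ℝ, (∀ x, IsPMF (J x)) → (∀ x, IsPMF (J' x)) →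
      ∃ x x' y, ζ ≤ |∑ a, V x a y * J x' a - ∑ a, V x' a y * J' x a| := by
  classical
  set D : Set (X → S → ℝ) := Set.univ.pi fun _ => stdSimplex ℝ S with hD
  have hDmem : ∀ J, J ∈ D ↔ ∀ x, IsPMF (J x) := by
    intro J
    simp [hD, IsPMF, stdSimplex]
  have hDc : IsCompact D := isCompact_univ_pi fun _ => isCompact_stdSimplex ℝ S
  set F : (X → S → ℝ) × (X → S → ℝ) → ℝ := fun JJ => ∑ a : X × X × Y,
    |∑ b, V a.1 b a.2.2 * JJ.1 a.2.1 b - ∑ b, V a.2.1 b a.2.2 * JJ.2 a.1 b| with hF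
  have hFc : Continuous F := by
    rw [hF]
    fun_prop
  rcases (D ×ˢ D).eq_empty_or_nonempty with h0 | h0
  · refine ⟨1, one_pos, fun J J' hJ hJ' => ?_⟩
    have : (J, J') ∈ D ×ˢ D := ⟨(hDmem J).2 hJ, (hDmem J').2 hJ'⟩
    rw [h0] at this
    exact this.elim
  obtain ⟨⟨J₀, J₁⟩, hmem, hmin⟩ := (hDc.prod hDc).exists_isMinOn h0 hFc.continuousOn
  have hF0 : 0 < F (J₀, J₁) := by
    refine lt_of_le_of_ne (Finset.sum_nonneg fun _ _ => abs_nonneg _) fun h => hns ?_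
    have h1 := (Finset.sum_eq_zero_iff_of_nonneg fun _ _ => abs_nonneg _).1 h.symm
    have h2 : ∀ x x' y, ∑ b, V x b y * J₀ x' b = ∑ b, V x' b y * J₁ x b := by
      intro x x' y
      have := h1 (x, x', y) (Finset.mem_univ _)
      exact sub_eq_zero.1 (abs_eq_zero.1 this)
    have hJ₀ := (hDmem J₀).1 hmem.1
    have hJ₁ := (hDmem J₁).1 hmem.2
    refine ⟨fun x s => (J₀ x s + J₁ x s) / 2, fun x => ⟨fun s => ?_, ?_⟩, fun x x' y => ?_⟩
    · have := (hJ₀ x).1 s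
      have := (hJ₁ x).1 s
      positivity
    · rw [← Finset.sum_div, Finset.sum_add_distrib, (hJ₀ x).2, (hJ₁ x).2]
      norm_num
    · have h3 := h2 x x' y
      have h4 := h2 x' x y
      simp_rw [mul_div_assoc', mul_add]
      rw [← Finset.sum_div, ← Finset.sum_div, Finset.sum_add_distrib, Finset.sum_add_distrib]
      linarith
  refine ⟨F (J₀, J₁) / (Fintype.card (X × X × Y) + 1), by positivity, fun J J' hJ hJ' => ?_⟩
  by_contra! hcon
  have h1 : F (J₀, J₁) ≤ F (J, J') := hmin ⟨(hDmem J).2 hJ, (hDmem J').2 hJ'⟩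
  have h2 : F (J, J') ≤ ∑ a : X × X × Y, F (J₀, J₁) / (Fintype.card (X × X × Y) + 1) :=
    Finset.sum_le_sum fun a _ => (hcon a.1 a.2.1 a.2.2).le
  rw [Finset.sum_const, nsmul_eq_mul, Finset.card_univ, mul_div_assoc', le_div_iff₀ (by positivity)]
    at h2
  nlinarith

/-- Average of a function over a finite type. -/
def avg {T : Type} [Fintype T] (f : T → ℝ) : ℝ := (Fintype.card T : ℝ)⁻¹ * ∑ t, f t

theorem avg_nonneg {T : Type} [Fintype T] {f : T → ℝ} (hf : ∀ t, 0 ≤ f t) : 0 ≤ avg f :=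
  mul_nonneg (by positivity) (Finset.sum_nonneg fun t _ => hf t)

theorem avg_mono {T : Type} [Fintype T] {f g : T → ℝ} (h : ∀ t, f t ≤ g t) : avg f ≤ avg g :=
  mul_le_mul_of_nonneg_left (Finset.sum_le_sum fun t _ => h t) (by positivity)

theorem avg_const_le {T : Type} [Fintype T] {c : ℝ} (hc : 0 ≤ c) : avg (fun _ : T => c) ≤ c := by
  unfold avg
  rw [Finset.sum_const, nsmul_eq_mul, Finset.card_univ, ← mul_assoc]
  exact mul_le_of_le_one_left hc inv_mul_le_one

theorem avg_add {T : Type} [Fintype T] (f g : T → ℝ) : avg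
    (fun t => f t + g t) = avg f + avg g := by
  unfold avg
  rw [Finset.sum_add_distrib, mul_add]

theorem avg_sub {T : Type} [Fintype T] (f g : T → ℝ) : avg
    (fun t => f t - g t) = avg f - avg g := by
  unfold avg
  rw [Finset.sum_sub_distrib, mul_sub]

theorem avg_mul_left {T : Type} [Fintype T] (c : ℝ) (f : T → ℝ) :
    avg (fun t => c * f t) = c * avg f := by
  unfold avg
  rw [← Finset.mul_sum, mul_left_comm]

theorem avg_sum {T ι : Type} [Fintype T] (B : Finset ι) (f : ι → T → ℝ) :
    avg (fun t => ∑ i ∈ B, f i t) = ∑ i ∈ B, avg (f i) := by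
  unfold avg
  rw [Finset.sum_comm, Finset.mul_sum]

theorem abs_avg_le {T : Type} [Fintype T] {f : T → ℝ} {c : ℝ} (hc : 0 ≤ c) (h : ∀ t, |f t| ≤ c) :
    |avg f| ≤ c := by
  rw [abs_le]
  constructor
  · have := avg_mono fun t => (neg_le_neg (h t)).trans (neg_abs_le (f t))
    have h2 := avg_const_le (T := T) hc
    have h3 := avg_mul_left (T := T) (-1) fun _ => c
    simp only [neg_one_mul] at h3
    linarith
  · exact (avg_mono fun t => (le_abs_self _).trans (h t)).trans (avg_const_le hc)

/-- Bessel's inequality for an almost orthogonal family. -/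
theorem sum_sq_avg_mul_le {T ι : Type} [Fintype T] (B : Finset ι) (φ : T → ℝ) (ψ : ι → T → ℝ)
    {C : ℝ} (hC : 0 < C) (hφ : avg (fun t => φ t ^ 2) ≤ 1)
    (hψ : ∀ i ∈ B, ∑ k ∈ B, |avg fun t => ψ i t * ψ k t| ≤ C) :
    ∑ i ∈ B, (avg fun t => φ t * ψ i t) ^ 2 ≤ C := by
  set c : ι → ℝ := fun i => avg fun t => φ t * ψ i t with hc
  set E : ι → ι → ℝ := fun i k => avg fun t => ψ i t * ψ k t with hE
  have hEs : ∀ i k, E i k = E k i := fun i k => by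
    simp only [hE]
    congr 1
    funext t
    ring
  have h0 : 0 ≤ avg fun t => (C * φ t - ∑ i ∈ B, c i * ψ i t) ^ 2 := avg_nonneg fun t => sq_nonneg _
  have h1 : (avg fun t => (C * φ t - ∑ i ∈ B, c i * ψ i t) ^ 2)
      = C ^ 2 * avg (fun t => φ t ^ 2) - 2 * C * ∑ i ∈ B, c i ^ 2
        + ∑ i ∈ B, ∑ k ∈ B, c i * c k * E i k := by
    have h2 : ∀ t, (C * φ t - ∑ i ∈ B, c i * ψ i t) ^ 2
        = C ^ 2 * φ t ^ 2 - 2 * C * (∑ i ∈ B, c i * (φ t * ψ i t))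
          + ∑ i ∈ B, ∑ k ∈ B, c i * c k * (ψ i t * ψ k t) := by
      intro t
      have h3 : ∑ i ∈ B, ∑ k ∈ B, c i * c k * (ψ i t * ψ k t) = (∑ i ∈ B, c i * ψ i t) ^ 2 := by
        rw [sq, Finset.sum_mul_sum]
        exact Finset.sum_congr rfl fun i _ => Finset.sum_congr rfl fun k _ => by ring
      have h4 : ∑ i ∈ B, c i * (φ t * ψ i t) = φ t * ∑ i ∈ B, c i * ψ i t := by
        rw [Finset.mul_sum]
        exact Finset.sum_congr rfl fun i _ => by ring
      rw [h3, h4]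
      ring
    simp_rw [h2]
    rw [avg_add, avg_sub, avg_mul_left, avg_mul_left, avg_sum, avg_sum]
    simp_rw [avg_sum, avg_mul_left, sq]
    rfl
  have h2 : ∑ i ∈ B, ∑ k ∈ B, c i * c k * E i k ≤ ∑ i ∈ B, c i ^ 2 * C := by
    calc _ ≤ ∑ i ∈ B, ∑ k ∈ B, (c i ^ 2 * |E i k| / 2 + c k ^ 2 * |E k i| / 2) := by
          refine Finset.sum_le_sum fun i _ => Finset.sum_le_sum fun k _ => ?_
          rw [hEs k i]
          have h3 : c i * c k * E i k ≤ |c i| * |c k| * |E i k| := by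
            rw [← abs_mul, ← abs_mul]
            exact le_abs_self _
          have h4 : |c i| * |c k| ≤ (c i ^ 2 + c k ^ 2) / 2 := by
            nlinarith [sq_nonneg (|c i| - |c k|), sq_abs (c i), sq_abs (c k)]
          nlinarith [mul_le_mul_of_nonneg_right h4 (abs_nonneg (E i k))]
      _ = ∑ i ∈ B, c i ^ 2 * ∑ k ∈ B, |E i k| := by
          simp_rw [Finset.sum_add_distrib]
          rw [Finset.sum_comm (f := fun i k => c k ^ 2 * |E k i| / 2), ← Finset.sum_add_distrib]
          refine Finset.sum_congr rfl fun i _ => ?_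
          rw [← Finset.sum_add_distrib, Finset.mul_sum]
          exact Finset.sum_congr rfl fun k _ => by ring
      _ ≤ _ := Finset.sum_le_sum fun i hi =>
          mul_le_mul_of_nonneg_left (hψ i hi) (sq_nonneg _)
  rw [← Finset.sum_mul] at h2
  nlinarith

/-- Averaging a centered function of one coordinate against a function of the others gives zero. -/
theorem sum_mul_eq_zero_of_update {κ : Type} [Fintype κ] [DecidableEq κ] [Nonempty X] (i : κ)
    {e : X → ℝ} (he : ∑ x, e x = 0) {G : (κ → X) → ℝ}
    (hG : ∀ t v, G (Function.update t i v) = G t) : ∑ t, e (t i) * G t = 0 := by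
  obtain ⟨v₀⟩ := ‹Nonempty X›
  rw [← (Equiv.funSplitAt i X).symm.sum_comp, Fintype.sum_prod_type, Finset.sum_comm]
  refine Finset.sum_eq_zero fun u _ => ?_
  have h1 : ∀ v, G ((Equiv.funSplitAt i X).symm (v, u))
      = G ((Equiv.funSplitAt i X).symm (v₀, u)) := by
    intro v
    rw [← hG ((Equiv.funSplitAt i X).symm (v₀, u)) v]
    congr 1
    funext k
    by_cases hk : k = i
    · subst hk
      simp [Equiv.funSplitAt, Equiv.piSplitAt]
    · simp [Equiv.funSplitAt, Equiv.piSplitAt, hk]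
  have h2 : ∀ v, ((Equiv.funSplitAt i X).symm (v, u)) i = v := by
    intro v
    simp [Equiv.funSplitAt, Equiv.piSplitAt]
  simp_rw [h1, h2]
  rw [← Finset.sum_mul, he, zero_mul]

/-- The messages for which the state sequence is correlated with the codewords are few. -/
theorem card_correlated_le [DecidableEq X] [Nonempty X] {κ : Type} [Fintype κ] [DecidableEq κ]
    (x x' : X) (φ : (κ → X) → ℝ) (hφ : ∀ t, |φ t| ≤ 1) {η : ℝ} (hη : 0 < η) (B : Finset κ)
    (hB : ∀ i ∈ B, ∃ j ≠ i, η < |avg fun t => φ t *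
      (((Fintype.card X : ℝ) * (if t i = x then 1 else 0) - 1)
        * ((Fintype.card X : ℝ) * if t j = x' then 1 else 0))|) :
    (B.card : ℝ) ≤ 2 * (Fintype.card X : ℝ) ^ 4 / η ^ 2 := by
  set w : ℝ := (Fintype.card X : ℝ) with hw
  have hw1 : 1 ≤ w := by
    rw [hw]
    exact_mod_cast Fintype.card_pos
  choose! j hj hjη using hB
  set e : X → X → ℝ := fun x v => w * (if v = x then 1 else 0) - 1 with he
  have he0 : ∀ x, ∑ v, e x v = 0 := by
    intro x
    simp [he, Finset.sum_sub_distrib, hw]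
  have hei : ∀ v, |e x v| ≤ w := by
    intro v
    simp only [he]
    split_ifs <;> rw [abs_le] <;> constructor <;> linarith
  set g : X → ℝ := fun v => w * if v = x' then 1 else 0 with hg
  have hgi : ∀ v, |g v| ≤ w := by
    intro v
    simp only [hg]
    split_ifs <;> rw [abs_le] <;> constructor <;> linarith
  set ψ : κ → (κ → X) → ℝ := fun i t => e x (t i) * g (t (j i)) with hψ
  have hψb : ∀ i t, |ψ i t| ≤ w ^ 2 := by
    intro i t
    rw [hψ, abs_mul, sq]
    exact mul_le_mul (hei _) (hgi _) (abs_nonneg _) (by linarith)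
  have hψψ : ∀ i k, |avg fun t => ψ i t * ψ k t| ≤ w ^ 4 := by
    intro i k
    refine abs_avg_le (by positivity) fun t => ?_
    rw [abs_mul, show w ^ 4 = w ^ 2 * w ^ 2 by ring]
    exact mul_le_mul (hψb i t) (hψb k t) (abs_nonneg _) (by positivity)
  have hzero : ∀ i ∈ B, ∀ k, k ≠ i → k ≠ j i → ∀ f : X → ℝ, ∀ m, m ≠ k →
      (avg fun t => ψ i t * (e x (t k) * f (t m))) = 0 := by
    intro i hi k hki hkj f m hm
    unfold avg
    have : ∑ t : κ → X, ψ i t * (e x (t k) * f (t m)) = ∑ t, e x (t k) * (ψ i t * f (t m)) :=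
      Finset.sum_congr rfl fun t _ => by ring
    rw [this, sum_mul_eq_zero_of_update k (he0 x), mul_zero]
    intro t v
    simp only [hψ]
    rw [Function.update_of_ne hki.symm, Function.update_of_ne hkj.symm, Function.update_of_ne hm]
  have hrow : ∀ i ∈ B, ∑ k ∈ B, |avg fun t => ψ i t * ψ k t| ≤ 2 * w ^ 4 := by
    intro i hi
    calc _ ≤ ∑ k ∈ B, ((if k = i then w ^ 4 else 0) + if k = j i then w ^ 4 else 0) := by
          refine Finset.sum_le_sum fun k hk => ?_
          by_cases h1 : k = i
          · rw [if_pos h1]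
            refine (hψψ i k).trans (le_add_of_nonneg_right ?_)
            split_ifs <;> positivity
          by_cases h2 : k = j i
          · rw [if_neg h1, if_pos h2, zero_add]
            exact hψψ i k
          · rw [if_neg h1, if_neg h2, hzero i hi k h1 h2 g (j k) (hj k hk)]
            simp
      _ ≤ w ^ 4 + w ^ 4 := by
          have hw4 : (0 : ℝ) ≤ w ^ 4 := by positivity
          rw [Finset.sum_add_distrib, Finset.sum_ite_eq', Finset.sum_ite_eq']
          refine add_le_add ?_ ?_ <;> split_ifs <;> simp [hw4]
      _ = 2 * w ^ 4 := by ring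
  have hφ2 : avg (fun t => φ t ^ 2) ≤ 1 := by
    refine (avg_mono fun t => ?_).trans (avg_const_le zero_le_one)
    rw [← sq_abs]
    exact pow_le_one₀ (abs_nonneg _) (hφ t)
  have hbes := sum_sq_avg_mul_le B φ ψ (by positivity : (0 : ℝ) < 2 * w ^ 4) hφ2 hrow
  rw [le_div_iff₀ (by positivity)]
  calc (B.card : ℝ) * η ^ 2 = ∑ i ∈ B, η ^ 2 := by rw [Finset.sum_const, nsmul_eq_mul]
    _ ≤ ∑ i ∈ B, (avg fun t => φ t * ψ i t) ^ 2 := by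
        refine Finset.sum_le_sum fun i hi => ?_
        rw [← sq_abs (avg _)]
        exact pow_le_pow_left₀ hη.le (hjη i hi).le 2
    _ ≤ 2 * w ^ 4 := hbes

/-- Two-sided tail bound for sums of independent centered variables bounded by one. -/
theorem sum_prod_mul_tail_le {ι A : Type} [Fintype ι] [DecidableEq ι] [Fintype A]
    (w ξ : ι → A → ℝ) (hw : ∀ i, IsPMF (w i)) (hξ : ∀ i a, |ξ i a| ≤ 1)
    (hm : ∀ i, ∑ a, w i a * ξ i a = 0) {d : ℝ} (hd : 0 < d) (hd2 : d ≤ 2) :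
    ∑ z : ι → A, (∏ i, w i (z i)) * (if d < |avg fun i => ξ i (z i)| then 1 else 0)
      ≤ 2 * Real.exp (-(Fintype.card ι * (d ^ 2 / 4))) := by
  have hE : ∀ σ : ℝ, |σ| = 1 → ∑ z : ι → A, (∏ i, w i (z i))
      * Real.exp (d / 2 * (-d * Fintype.card ι) - d / 2 * ∑ i, σ * ξ i (z i))
      ≤ Real.exp (-(Fintype.card ι * (d ^ 2 / 4))) := by
    intro σ hσ
    have h := sum_prod_mul_exp_le w (fun i a => σ * ξ i a) (fun i => (hw i).1) (fun i => (hw i).2)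
      (B := 1) (m := 0) (l := d / 2) (by positivity)
      (fun i a => by rw [abs_mul, hσ, one_mul]; exact hξ i a) (by linarith)
      (fun i => by
        simp_rw [mul_left_comm]
        rw [← Finset.mul_sum, hm, mul_zero])
    have h2 := mul_le_mul_of_nonneg_left h (Real.exp_pos (d / 2 * (-d * Fintype.card ι))).le
    rw [← Real.exp_add, Finset.mul_sum] at h2
    calc _ = _ := Finset.sum_congr rfl fun z _ => by
          rw [mul_left_comm (Real.exp _), ← Real.exp_add, ← sub_eq_add_neg]
      _ ≤ _ := h2
      _ = _ := by ring_nf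
  have h1 := hE 1 (by simp)
  have h2 := hE (-1) (by simp)
  rw [two_mul]
  refine le_trans ?_ (add_le_add h1 h2)
  rw [← Finset.sum_add_distrib]
  refine Finset.sum_le_sum fun z _ => ?_
  rw [← mul_add]
  refine mul_le_mul_of_nonneg_left ?_ (Finset.prod_nonneg fun i _ => (hw i).1 _)
  split_ifs with h
  · have hc : (0 : ℝ) < Fintype.card ι := by
      rcases (Fintype.card ι).eq_zero_or_pos with h0 | h0
      · unfold avg at h
        rw [h0] at h
        simp at h
        linarith
      · exact_mod_cast h0
    unfold avg at h
    rw [abs_mul, abs_of_pos (inv_pos.2 hc), inv_mul_eq_div, lt_div_iff₀ hc, lt_abs] at h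
    rcases h with h | h
    · refine le_add_of_nonneg_of_le (Real.exp_pos _).le ?_
      rw [Real.one_le_exp_iff, ← Finset.mul_sum]
      nlinarith
    · refine le_add_of_le_of_nonneg ?_ (Real.exp_pos _).le
      rw [Real.one_le_exp_iff, ← Finset.mul_sum]
      nlinarith
  · positivity

/-- The output `y` of the product code looks like message `i`: every other codeword is explained
by a symmetrizing family. -/
def Compatible [DecidableEq X] [DecidableEq Y] {κ : Type} [Fintype κ] [DecidableEq κ]
    (V : X → S → Y → ℝ) (δ : ℝ) (y : (κ → X) → Y) (i : κ) : Prop :=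
  ∀ j ≠ i, ∃ J : X → S → ℝ, (∀ x, IsPMF (J x)) ∧ ∀ x x' b,
    |avg (fun t => ((Fintype.card X : ℝ) * (if t i = x then 1 else 0))
      * ((Fintype.card X : ℝ) * if t j = x' then 1 else 0) * if y t = b then 1 else 0)
      - ∑ a, V x a b * J x' a| ≤ δ

theorem Compatible.unique {Y : Type} [DecidableEq X] [DecidableEq Y] {κ : Type} [Fintype κ]
    [DecidableEq κ]
    {V : X → S → Y → ℝ} {δ ζ : ℝ} (hδ : 2 * δ < ζ)
    (hζ : ∀ J J' : X → S → ℝ, (∀ x, IsPMF (J x)) → (∀ x, IsPMF (J' x)) →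
      ∃ x x' y, ζ ≤ |∑ a, V x a y * J x' a - ∑ a, V x' a y * J' x a|)
    {y : (κ → X) → Y} {i i' : κ} (h : Compatible V δ y i) (h' : Compatible V δ y i') : i = i' := by
  by_contra hne
  obtain ⟨J, hJ, hJd⟩ := h i' (Ne.symm hne)
  obtain ⟨J', hJ', hJd'⟩ := h' i hne
  obtain ⟨x, x', b, hb⟩ := hζ J J' hJ hJ'
  have h1 := hJd x x' b
  have h2 := hJd' x' x b
  have h3 : (fun t : κ → X => ((Fintype.card X : ℝ) * (if t i' = x' then 1 else 0))
      * ((Fintype.card X : ℝ) * if t i = x then 1 else 0) * if y t = b then 1 else 0)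
      = fun t => ((Fintype.card X : ℝ) * (if t i = x then 1 else 0))
      * ((Fintype.card X : ℝ) * if t i' = x' then 1 else 0) * if y t = b then 1 else 0 := by
    funext t
    ring
  rw [h3] at h2
  rw [abs_le] at h1 h2
  have := hb.trans (abs_le.2 ⟨by linarith [h1.1, h2.2], by linarith [h1.2, h2.1]⟩ :
    _ ≤ 2 * δ)
  linarith

theorem IsPMF.le_one {A : Type} [Fintype A] {p : A → ℝ} (hp : IsPMF p) (a : A) : p a ≤ 1 := by
  rw [← hp.2]
  exact Finset.single_le_sum (fun a _ => hp.1 a) (Finset.mem_univ a)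

theorem avg_card_mul_indicator [DecidableEq X] [Nonempty X] {κ : Type} [Fintype κ] [DecidableEq κ]
    (j : κ) (x : X) :
    (avg fun t : κ → X => (Fintype.card X : ℝ) * if t j = x then 1 else 0) = 1 := by
  have h1 : (avg fun t : κ → X =>
      (Fintype.card X : ℝ) * (if t j = x then 1 else 0) - 1) = 0 := by
    unfold avg
    have := sum_mul_eq_zero_of_update j
      (e := fun v => (Fintype.card X : ℝ) * (if v = x then 1 else 0) - 1)
      (by simp [Finset.sum_sub_distrib]) (G := fun _ => 1) (fun _ _ => rfl)
    simp only [mul_one] at this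
    rw [this, mul_zero]
  rw [avg_sub] at h1
  have h2 : (avg fun _ : κ → X => (1 : ℝ)) = 1 := by
    unfold avg
    simp
  linarith

theorem exists_deviation_of_not_compatible [DecidableEq X] [DecidableEq S] [DecidableEq Y]
    [Nonempty X] {κ : Type} [Fintype κ] [DecidableEq κ] {V : X → S → Y → ℝ} (hV : IsChannel V)
    {δ η : ℝ} (hη : Fintype.card S * η ≤ δ / 2) (s : (κ → X) → S) {i : κ}
    (hi : ∀ j ≠ i, ∀ x x' a, |avg fun t => (if s t = a then 1 else 0) *
      (((Fintype.card X : ℝ) * (if t i = x then 1 else 0) - 1)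
        * ((Fintype.card X : ℝ) * if t j = x' then 1 else 0))| ≤ η)
    {y : (κ → X) → Y} (hy : ¬ Compatible V δ y i) :
    ∃ a : κ × X × X × Y, δ / 2 <
      |avg fun t => ((Fintype.card X : ℝ) * (if t i = a.2.1 then 1 else 0))
        * ((Fintype.card X : ℝ) * if t a.1 = a.2.2.1 then 1 else 0)
        * ((if y t = a.2.2.2 then 1 else 0) - V a.2.1 (s t) a.2.2.2)| := by
  set w : ℝ := (Fintype.card X : ℝ) with hw
  by_contra! hcon
  refine hy fun j hj => ?_
  refine ⟨fun x' a => avg fun t => (if s t = a then 1 else 0) * (w * if t j = x' then 1 else 0),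
    fun x' => ⟨fun a => avg_nonneg fun t => by positivity, ?_⟩, fun x x' b => ?_⟩
  · rw [← avg_sum]
    refine Eq.trans ?_ (avg_card_mul_indicator j x')
    congr 1
    funext t
    rw [← Finset.sum_mul, Finset.sum_ite_eq Finset.univ (s t)]
    simp [hw]
  have h1 := hcon (j, x, x', b)
  simp only at h1
  set D := avg fun t => (w * (if t i = x then 1 else 0)) * (w * if t j = x' then 1 else 0)
    * ((if y t = b then 1 else 0) - V x (s t) b) with hD
  have h2 : avg (fun t => (w * (if t i = x then 1 else 0))
      * (w * if t j = x' then 1 else 0) * if y t = b then 1 else 0)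
      - ∑ a, V x a b * (avg fun t => (if s t = a then 1 else 0) * (w * if t j = x' then 1 else 0))
      = D + ∑ a, V x a b * avg fun t => (if s t = a then 1 else 0) *
        ((w * (if t i = x then 1 else 0) - 1) * (w * if t j = x' then 1 else 0)) := by
    simp_rw [hD, ← avg_mul_left]
    rw [← avg_sum, ← avg_sum, ← avg_add, ← avg_sub]
    congr 1
    funext t
    have h3 : ∀ f : S → ℝ, ∑ a, V x a b * ((if s t = a then 1 else 0) * f a)
        = V x (s t) b * f (s t) := by
      intro f
      rw [Finset.sum_eq_single (s t)]
      · simp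
      · intro a _ ha
        simp [ha.symm]
      · simp
    rw [h3 fun _ => _, h3 fun _ => _]
    ring
  rw [h2]
  have h4 : |∑ a, V x a b * avg fun t => (if s t = a then 1 else 0) *
      ((w * (if t i = x then 1 else 0) - 1) * (w * if t j = x' then 1 else 0))|
      ≤ Fintype.card S * η := by
    refine (Finset.abs_sum_le_sum_abs _ _).trans ?_
    rw [← Finset.card_univ, ← nsmul_eq_mul, ← Finset.sum_const]
    refine Finset.sum_le_sum fun a _ => ?_
    rw [abs_mul, abs_of_nonneg ((hV x a).1 b)]
    exact (mul_le_of_le_one_left (abs_nonneg _) ((hV x a).le_one b)).trans (hi j hj x x' a)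
  calc _ ≤ _ := abs_add_le _ _
    _ ≤ δ / 2 + δ / 2 := add_le_add h1 (h4.trans hη)
    _ = δ := by ring

theorem sum_not_compatible_le [DecidableEq X] [DecidableEq S] [DecidableEq Y]
    [Nonempty X] {κ : Type} [Fintype κ] [DecidableEq κ] {V : X → S → Y → ℝ} (hV : IsChannel V)
    {δ η : ℝ} (hδ : 0 < δ) (hδ1 : δ ≤ 1) (hη : Fintype.card S * η ≤ δ / 2) (s : (κ → X) → S) {i : κ}
    (hi : ∀ j ≠ i, ∀ x x' a, |avg fun t => (if s t = a then 1 else 0) *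
      (((Fintype.card X : ℝ) * (if t i = x then 1 else 0) - 1)
        * ((Fintype.card X : ℝ) * if t j = x' then 1 else 0))| ≤ η)
    [DecidablePred fun y : (κ → X) → Y => Compatible V δ y i] :
    ∑ y : (κ → X) → Y, (∏ t, V (t i) (s t) (y t)) * (if Compatible V δ y i then 0 else 1)
      ≤ Fintype.card (κ × X × X × Y) * (2 * Real.exp (-((Fintype.card X : ℝ) ^ Fintype.card κ
        * ((δ / (2 * (Fintype.card X : ℝ) ^ 2)) ^ 2 / 4)))) := by
  have hdev := fun y => exists_deviation_of_not_compatible (y := y) hV hη s hi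
  set w : ℝ := (Fintype.card X : ℝ) with hw
  have hw1 : 1 ≤ w := by
    rw [hw]
    exact_mod_cast Fintype.card_pos
  set d := δ / (2 * w ^ 2) with hd
  have hd0 : 0 < d := by positivity
  have hd2 : d ≤ 2 := by
    rw [hd, div_le_iff₀ (by positivity)]
    nlinarith [one_le_pow₀ hw1 (n := 2)]
  set ξ : κ × X × X × Y → (κ → X) → Y → ℝ := fun a t v =>
    (if t i = a.2.1 then 1 else 0) * (if t a.1 = a.2.2.1 then 1 else 0)
      * ((if v = a.2.2.2 then 1 else 0) - V a.2.1 (s t) a.2.2.2) with hξ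
  have hξ1 : ∀ a t v, |ξ a t v| ≤ 1 := by
    intro a t v
    have h1 := (hV a.2.1 (s t)).1 a.2.2.2
    have h2 := (hV a.2.1 (s t)).le_one a.2.2.2
    simp only [hξ]
    split_ifs <;> rw [abs_le] <;> constructor <;> linarith
  have hξ0 : ∀ a t, ∑ v, V (t i) (s t) v * ξ a t v = 0 := by
    intro a t
    by_cases h : t i = a.2.1
    · have h1 : ∀ v, V (t i) (s t) v * ξ a t v = (if t a.1 = a.2.2.1 then 1 else 0) *
          (V a.2.1 (s t) v * (if v = a.2.2.2 then 1 else 0)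
            - V a.2.1 (s t) v * V a.2.1 (s t) a.2.2.2) := by
        intro v
        simp only [hξ, h, if_true]
        ring
      simp_rw [h1]
      rw [← Finset.mul_sum, Finset.sum_sub_distrib, ← Finset.sum_mul, (hV _ _).2]
      simp
    · simp [hξ, h]
  have hT : (Fintype.card (κ → X) : ℝ) = w ^ Fintype.card κ := by
    rw [Fintype.card_fun, Nat.cast_pow]
  calc _ ≤ ∑ y : (κ → X) → Y, ∑ a : κ × X × X × Y,
        (∏ t, V (t i) (s t) (y t)) * (if d < |avg fun t => ξ a t (y t)| then 1 else 0) := by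
        refine Finset.sum_le_sum fun y _ => ?_
        rw [← Finset.mul_sum]
        refine mul_le_mul_of_nonneg_left ?_ (Finset.prod_nonneg fun t _ => (hV _ _).1 _)
        have hnn : ∀ a : κ × X × X × Y,
            (0 : ℝ) ≤ if d < |avg fun t => ξ a t (y t)| then 1 else 0 := fun a => by positivity
        split_ifs with hc
        · exact Finset.sum_nonneg fun a _ => hnn a
        · obtain ⟨a, ha⟩ := hdev y hc
          have h1 : (avg fun t => (w * (if t i = a.2.1 then 1 else 0))
              * (w * if t a.1 = a.2.2.1 then 1 else 0)
              * ((if y t = a.2.2.2 then 1 else 0) - V a.2.1 (s t) a.2.2.2))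
              = w ^ 2 * avg fun t => ξ a t (y t) := by
            rw [← avg_mul_left]
            congr 1
            funext t
            simp only [hξ]
            ring
          rw [h1, abs_mul, abs_of_nonneg (by positivity)] at ha
          have h2 : d < |avg fun t => ξ a t (y t)| := by
            rw [hd, div_lt_iff₀ (by positivity)]
            linarith
          calc (1 : ℝ) = if d < |avg fun t => ξ a t (y t)| then 1 else 0 := by rw [if_pos h2]
            _ ≤ _ := Finset.single_le_sum
              (f := fun a => if d < |avg fun t => ξ a t (y t)| then (1 : ℝ) else 0)
              (fun a _ => hnn a) (Finset.mem_univ a)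
    _ ≤ ∑ a : κ × X × X × Y, 2 * Real.exp (-(w ^ Fintype.card κ * (d ^ 2 / 4))) := by
        rw [Finset.sum_comm]
        refine Finset.sum_le_sum fun a _ => ?_
        rw [← hT]
        exact sum_prod_mul_tail_le (fun t v => V (t i) (s t) v) (ξ a) (fun t => hV _ _) (hξ1 a)
          (hξ0 a) hd0 hd2
    _ = _ := by rw [Finset.sum_const, nsmul_eq_mul, Finset.card_univ]

/-- Error bound for the product code with `K` messages of block length `|X| ^ K`. -/
theorem exists_decoder_blockErr_le [DecidableEq X] [Nonempty X] {V : X → S → Y → ℝ}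
    (hV : IsChannel V) (hns : ¬ Symmetrizable V) :
    ∃ B c : ℝ, 0 < c ∧ ∀ K : ℕ, 0 < K → ∃ d : ((Fin K → X) → Y) → Fin K, ∀ s : (Fin K → X) → S,
      blockErr V (fun i t => t i) d s
        ≤ B / K + B * K * Real.exp (-(c * (Fintype.card X : ℝ) ^ K)) := by
  classical
  obtain ⟨ζ, hζ, hgap⟩ := exists_symmetrizing_gap hns
  set w : ℝ := (Fintype.card X : ℝ) with hw
  have hw1 : 1 ≤ w := by
    rw [hw]
    exact_mod_cast Fintype.card_pos
  set δ := min 1 (ζ / 3) with hδ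
  have hδ0 : 0 < δ := lt_min one_pos (by positivity)
  have hδ1 : δ ≤ 1 := min_le_left _ _
  have hδζ : 2 * δ < ζ := by
    have := min_le_right 1 (ζ / 3)
    linarith
  set η := δ / (2 * (Fintype.card S + 1)) with hη
  have hη0 : 0 < η := by positivity
  have hηS : Fintype.card S * η ≤ δ / 2 := by
    rw [hη, mul_div_assoc', div_le_div_iff₀ (by positivity) (by positivity)]
    nlinarith
  set c := (δ / (2 * w ^ 2)) ^ 2 / 4 with hc
  set B₁ : ℝ := Fintype.card (X × X × S) * (2 * w ^ 4 / η ^ 2) with hB₁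
  set B₂ : ℝ := Fintype.card (X × X × Y) * 2 with hB₂
  have hB₁0 : 0 ≤ B₁ := by positivity
  have hB₂0 : 0 ≤ B₂ := by positivity
  refine ⟨B₁ + B₂, c, by positivity, fun K hK => ?_⟩
  have : Nonempty (Fin K) := ⟨⟨0, hK⟩⟩
  have hK' : (0 : ℝ) < K := by exact_mod_cast hK
  refine ⟨fun y => Classical.epsilon fun i => Compatible V δ y i, fun s => ?_⟩
  set d : ((Fin K → X) → Y) → Fin K := fun y => Classical.epsilon fun i => Compatible V δ y i with hd
  have hdc : ∀ y i, Compatible V δ y i → d y = i := fun y i h =>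
    Compatible.unique hδζ hgap (Classical.epsilon_spec (p := fun i => Compatible V δ y i) ⟨i, h⟩) h
  set q : X × X × S → Fin K → Prop := fun a i => ∃ j ≠ i,
    η < |avg fun t : Fin K → X => (if s t = a.2.2 then 1 else 0) *
      ((w * (if t i = a.1 then 1 else 0) - 1) * (w * if t j = a.2.1 then 1 else 0))| with hq
  set bad : Finset (Fin K) := Finset.univ.biUnion fun a => Finset.univ.filter (q a) with hbad
  have hbadc : (bad.card : ℝ) ≤ B₁ := by
    calc (bad.card : ℝ) ≤ ∑ a : X × X × S, ((Finset.univ.filter (q a)).card : ℝ) := by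
          exact_mod_cast Finset.card_biUnion_le
      _ ≤ ∑ a : X × X × S, 2 * w ^ 4 / η ^ 2 := by
          refine Finset.sum_le_sum fun a _ => ?_
          refine card_correlated_le a.1 a.2.1 (fun t => if s t = a.2.2 then 1 else 0)
            (fun t => by split_ifs <;> simp) hη0 _ fun i hi => ?_
          exact (Finset.mem_filter.1 hi).2
      _ = B₁ := by rw [Finset.sum_const, nsmul_eq_mul, Finset.card_univ]
  set E := Real.exp (-(c * w ^ K)) with hE
  have hE0 : 0 < E := Real.exp_pos _
  have herr : ∀ i, (∑ y, if d y = i then 0 else ∏ t, V (t i) (s t) (y t))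
      ≤ (if i ∈ bad then 1 else 0) + B₂ * K * E := by
    intro i
    have hPMF : IsPMF fun y : (Fin K → X) → Y => ∏ t, V (t i) (s t) (y t) :=
      isPMF_pi fun t => hV (t i) (s t)
    split_ifs with hi
    · refine le_add_of_le_of_nonneg ?_ (by positivity)
      rw [← hPMF.2]
      refine Finset.sum_le_sum fun y _ => ?_
      split_ifs
      · exact hPMF.1 y
      · exact le_rfl
    · rw [zero_add]
      have hgood : ∀ j ≠ i, ∀ x x' a, |avg fun t : Fin K → X => (if s t = a then 1 else 0) *
          ((w * (if t i = x then 1 else 0) - 1) * (w * if t j = x' then 1 else 0))| ≤ η := by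
        intro j hj x x' a
        by_contra! h
        exact hi (Finset.mem_biUnion.2 ⟨(x, x', a), Finset.mem_univ _,
          Finset.mem_filter.2 ⟨Finset.mem_univ _, j, hj, h⟩⟩)
      refine le_trans ?_ ((sum_not_compatible_le hV hδ0 hδ1 hηS s hgood).trans_eq ?_)
      · refine Finset.sum_le_sum fun y _ => ?_
        by_cases h : Compatible V δ y i
        · simp [h, hdc y i h]
        · rw [if_neg h, mul_one]
          split_ifs
          · exact hPMF.1 y
          · exact le_rfl
      · rw [Fintype.card_prod, Fintype.card_fin, Nat.cast_mul, hE, hB₂, mul_comm c]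
        ring
  unfold blockErr
  rw [Fintype.card_fin]
  calc _ ≤ (K : ℝ)⁻¹ * ∑ i : Fin K, ((if i ∈ bad then 1 else 0) + B₂ * K * E) := by
        gcongr with i
        exact herr i
    _ = bad.card / K + B₂ * K * E := by
        rw [Finset.sum_add_distrib, Finset.sum_ite_mem, Finset.univ_inter]
        simp only [Finset.sum_const, Finset.card_univ, Fintype.card_fin, nsmul_eq_mul, mul_one]
        field_simp
    _ ≤ (B₁ + B₂) / K + (B₁ + B₂) * K * E := by
        gcongr <;> linarith

/-- Over a non-symmetrizable channel, all large enough numbers of messages can be transmitted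
reliably with a block length depending only on the number of messages. -/
theorem exists_prefix_code [DecidableEq X] [Nonempty X] [Nonempty S] {V : X → S → Y → ℝ}
    (hV : IsChannel V) (hns : ¬ Symmetrizable V) {ε : ℝ} (hε : 0 < ε) :
    ∃ K₀ : ℕ, ∀ K ≥ K₀, ∃ d : ((Fin K → X) → Y) → Fin K, ∀ s : (Fin K → X) → S,
      blockErr V (fun i t => t i) d s ≤ ε := by
  classical
  obtain ⟨B, c, hc, h⟩ := exists_decoder_blockErr_le hV hns
  have hX : 1 < (Fintype.card X : ℝ) := by
    have h1 : Nontrivial X := by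
      by_contra hX
      rw [not_nontrivial_iff_subsingleton] at hX
      obtain ⟨a⟩ := ‹Nonempty S›
      refine hns ⟨fun _ s => if s = a then 1 else 0,
        fun _ => ⟨fun s => by positivity, by simp⟩, fun x x' z => ?_⟩
      rw [Subsingleton.elim x x']
    exact_mod_cast Fintype.one_lt_card
  have hlim : Filter.Tendsto (fun K : ℕ => B / (K : ℝ)
      + B * K * Real.exp (-(c * (Fintype.card X : ℝ) ^ K))) Filter.atTop (nhds 0) := by
    have h1 := tendsto_const_div_atTop_nhds_zero_nat B
    have h2 : Filter.Tendsto (fun K : ℕ => (|B| / c) * ((K : ℝ) / (Fintype.card X : ℝ) ^ K))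
        Filter.atTop (nhds 0) := by
      have := (tendsto_pow_const_div_const_pow_of_one_lt 1 hX).const_mul (|B| / c)
      simpa using this
    have h3 : Filter.Tendsto (fun K : ℕ => B * K * Real.exp (-(c * (Fintype.card X : ℝ) ^ K)))
        Filter.atTop (nhds 0) := by
      refine squeeze_zero_norm (fun K => ?_) h2
      have hu : 0 < c * (Fintype.card X : ℝ) ^ K := by positivity
      have h4 : Real.exp (-(c * (Fintype.card X : ℝ) ^ K)) ≤ (c * (Fintype.card X : ℝ) ^ K)⁻¹ := by
        rw [Real.exp_neg]
        exact inv_anti₀ hu (by linarith [Real.add_one_le_exp (c * (Fintype.card X : ℝ) ^ K)])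
      rw [norm_mul, norm_mul, Real.norm_eq_abs, Real.norm_natCast, Real.norm_eq_abs, Real.abs_exp]
      calc _ ≤ |B| * K * (c * (Fintype.card X : ℝ) ^ K)⁻¹ := by gcongr
        _ = _ := by
          field_simp
    simpa using h1.add h3
  obtain ⟨K₀, hK₀⟩ := Filter.eventually_atTop.1 (hlim.eventually (ge_mem_nhds hε))
  refine ⟨max K₀ 1, fun K hK => ?_⟩
  obtain ⟨d, hd⟩ := h K (by have := (le_max_right K₀ 1).trans hK; lia)
  exact ⟨d, fun s => (hd s).trans (hK₀ K ((le_max_left _ _).trans hK))⟩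

end PrefixCode

section Converse

variable {X S Y Z : Type} [Fintype Y]

theorem sum_large_likelihood_le {ι : Type} [Fintype ι] [DecidableEq ι] {U : X → Y → ℝ}
    (hU : ∀ x, IsPMF (U x)) {Q : Y → ℝ} (hQ : IsPMF Q) (hQU : ∀ x y, Q y = 0 → U x y = 0)
    {B D l a : ℝ} (hl : 0 ≤ l) (hB : ∀ x y, |Real.log (U x y / Q y)| ≤ B) (hlB : l * B ≤ 1)
    (hD : ∀ x, ∑ y, U x y * Real.log (U x y / Q y) ≤ D) (x : ι → X) :
    ∑ y : ι → Y, (∏ i, U (x i) (y i)) *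
        (if Real.exp (Fintype.card ι * a) * ∏ i, Q (y i) < ∏ i, U (x i) (y i) then 1 else 0)
      ≤ Real.exp (Fintype.card ι * (l ^ 2 * B ^ 2 - l * (a - D))) := by
  have hC := sum_prod_mul_exp_le (fun i y => U (x i) y)
    (fun i y => -Real.log (U (x i) y / Q y)) (fun i => (hU _).1) (fun i => (hU _).2) hl
    (fun i y => by rw [abs_neg]; exact hB _ _) hlB (m := -D) (fun i => by
      simp_rw [mul_neg]
      rw [Finset.sum_neg_distrib]
      exact neg_le_neg (hD _))
  have hE : Real.exp (Fintype.card ι * (l ^ 2 * B ^ 2 - l * (a - D)))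
      = Real.exp (-(l * (Fintype.card ι * a)))
        * Real.exp (Fintype.card ι * (l ^ 2 * B ^ 2 - l * -D)) := by
    rw [← Real.exp_add]
    ring_nf
  rw [hE]
  refine le_trans ?_ (mul_le_mul_of_nonneg_left hC (Real.exp_pos _).le)
  rw [Finset.mul_sum]
  refine Finset.sum_le_sum fun y _ => ?_
  rw [mul_left_comm]
  have hP : 0 ≤ ∏ i, U (x i) (y i) := Finset.prod_nonneg fun i _ => (hU _).1 _
  refine (hP.eq_or_lt).elim (fun h => by rw [← h]; simp) fun h => ?_
  refine mul_le_mul_of_nonneg_left ?_ hP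
  rw [← Real.exp_add]
  split_ifs with h1
  · rw [Real.one_le_exp_iff]
    have hUpos : ∀ i, 0 < U (x i) (y i) := fun i => ((hU _).1 _).lt_of_ne' fun h0 => by
      rw [Finset.prod_eq_zero (f := fun i => U (x i) (y i)) (Finset.mem_univ i) h0] at h
      exact h.ne rfl
    have hQpos : ∀ i, 0 < Q (y i) := fun i => (hQ.1 _).lt_of_ne' fun h0 =>
      (hUpos i).ne' (hQU _ _ h0)
    have h2 : Fintype.card ι * a ≤ ∑ i, Real.log (U (x i) (y i) / Q (y i)) := by
      rw [← Real.log_prod fun i _ => (div_pos (hUpos i) (hQpos i)).ne', Finset.prod_div_distrib,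
        Real.le_log_iff_exp_le (div_pos h (Finset.prod_pos fun i _ => hQpos i)),
        le_div_iff₀ (Finset.prod_pos fun i _ => hQpos i)]
      exact h1.le
    rw [Finset.sum_neg_distrib]
    nlinarith
  · positivity

/-- Strong converse bound at a fixed block length. -/
theorem sum_correct_le [Fintype Z] {ι μ : Type} [Fintype ι] [DecidableEq ι] [Fintype μ]
    [DecidableEq μ] {U : X → Y → ℝ}
    (hU : ∀ x, IsPMF (U x)) {V : Y → Z → ℝ} (hV : ∀ y, IsPMF (V y)) {Q : Y → ℝ} (hQ : IsPMF Q)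
    (hQU : ∀ x y, Q y = 0 → U x y = 0)
    {B D l a : ℝ} (hl : 0 ≤ l) (hB : ∀ x y, |Real.log (U x y / Q y)| ≤ B) (hlB : l * B ≤ 1)
    (hD : ∀ x, ∑ y, U x y * Real.log (U x y / Q y) ≤ D) (c : μ → ι → X)
    (g : (ι → Y) → (ι → Z) → μ) :
    ∑ m, ∑ y, ∑ z, (if g y z = m then (∏ i, U (c m i) (y i)) * ∏ i, V (y i) (z i) else 0)
      ≤ Real.exp (Fintype.card ι * a)
        + Fintype.card μ * Real.exp (Fintype.card ι * (l ^ 2 * B ^ 2 - l * (a - D))) := by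
  have hVP : ∀ y : ι → Y, IsPMF fun z : ι → Z => ∏ i, V (y i) (z i) :=
    fun y => isPMF_pi fun i => hV (y i)
  have hQP : IsPMF fun y : ι → Y => ∏ i, Q (y i) := isPMF_pi fun _ => hQ
  set τ := Real.exp (Fintype.card ι * a) with hτ
  have hτ0 : 0 < τ := Real.exp_pos _
  calc _ ≤ ∑ m, ∑ y, ∑ z, ((if g y z = m then τ * ((∏ i, Q (y i)) * ∏ i, V (y i) (z i)) else 0)
        + ((∏ i, U (c m i) (y i)) * (if τ * ∏ i, Q (y i) < ∏ i, U (c m i) (y i) then 1 else 0))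
          * ∏ i, V (y i) (z i)) := by
        refine Finset.sum_le_sum fun m _ => Finset.sum_le_sum fun y _ => Finset.sum_le_sum
          fun z _ => ?_
        have h1 := (hVP y).1 z
        have h2 := hQP.1 y
        have h3 : 0 ≤ ∏ i, U (c m i) (y i) := Finset.prod_nonneg fun i _ => (hU _).1 _
        simp only at h1 h2
        by_cases h4 : g y z = m
        · rw [if_pos h4, if_pos h4]
          split_ifs with h5
          · rw [mul_one]
            exact le_add_of_nonneg_left (by positivity)
          · rw [mul_zero, zero_mul, add_zero, ← mul_assoc]
            exact mul_le_mul_of_nonneg_right (not_lt.1 h5) h1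
        · rw [if_neg h4, if_neg h4, zero_add]
          exact mul_nonneg (mul_nonneg h3 (by positivity)) h1
    _ = τ + ∑ m, ∑ y : ι → Y, (∏ i, U (c m i) (y i)) *
          (if τ * ∏ i, Q (y i) < ∏ i, U (c m i) (y i) then 1 else 0) := by
        simp_rw [Finset.sum_add_distrib, ← Finset.mul_sum, (hVP _).2, mul_one]
        congr 1
        rw [Finset.sum_comm]
        simp_rw [Finset.sum_comm (s := (Finset.univ : Finset μ)), Finset.sum_ite_eq,
          Finset.mem_univ, if_true, ← Finset.mul_sum, (hVP _).2, mul_one, hQP.2, mul_one]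
    _ ≤ τ + ∑ m : μ, Real.exp (Fintype.card ι * (l ^ 2 * B ^ 2 - l * (a - D))) := by
        gcongr with m
        exact sum_large_likelihood_le hU hQ hQU hl hB hlB hD (c m)
    _ = _ := by rw [Finset.sum_const, nsmul_eq_mul, Finset.card_univ]

theorem achievable_le [Fintype X] [Fintype S] [Fintype Z] [Nonempty X] {W : X → S → Y × Z → ℝ}
    {WY : X → S → Y → ℝ}
    (hWY : IsChannel WY) {V : Y → Z → ℝ} (hV : ∀ y, IsPMF (V y))
    (hW : ∀ x s y z, W x s (y, z) = WY x s y * V y z) {C1 R C : ℝ} (hR : AVRCAchievable W C1 R)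
    {q : S → ℝ} (hq : IsPMF q) (hC0 : 0 ≤ C) (hC : ∀ p, IsPMF p → natMI p (avgCh WY q) ≤ C) :
    R * Real.log 2 ≤ C := by
  by_contra! hlt
  set δ := (R * Real.log 2 - C) / 4 with hδ
  have hδ0 : 0 < δ := by rw [hδ]; linarith
  set U := avgCh WY q with hUdef
  have hU : ∀ x, IsPMF (U x) := avgCh_isPMF hWY hq
  obtain ⟨Q, hQ, hQU, hD⟩ := exists_output_metric hU hC0 hδ0 hC
  obtain ⟨B, hB1, hB⟩ : ∃ B : ℝ, 1 ≤ B ∧ ∀ x y, |Real.log (U x y / Q y)| ≤ B := by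
    refine ⟨1 + ∑ a : X × Y, |Real.log (U a.1 a.2 / Q a.2)|, ?_, fun x y => ?_⟩
    · linarith [Finset.sum_nonneg fun (a : X × Y) (_ : a ∈ Finset.univ) =>
        abs_nonneg (Real.log (U a.1 a.2 / Q a.2))]
    · have := Finset.single_le_sum (f := fun a : X × Y => |Real.log (U a.1 a.2 / Q a.2)|)
        (fun a _ => abs_nonneg _) (Finset.mem_univ (x, y))
      linarith
  have hB0 : 0 < B := by linarith
  set l := min (1 / B) (δ / (2 * B ^ 2)) with hl
  have hl0 : 0 < l := lt_min (by positivity) (by positivity)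
  have hlB : l * B ≤ 1 := by
    have := min_le_left (1 / B) (δ / (2 * B ^ 2))
    rw [← hl, le_div_iff₀ hB0] at this
    exact this
  have hlB2 : l * B ^ 2 ≤ δ / 2 := by
    have := min_le_right (1 / B) (δ / (2 * B ^ 2))
    rw [← hl, le_div_iff₀ (by positivity)] at this
    linarith
  have hexp : ∀ κ : ℝ, 0 < κ → ∀ᶠ n : ℕ in Filter.atTop, Real.exp (-(n * κ)) ≤ 1 / 8 := by
    intro κ hκ
    have h1 : Filter.Tendsto (fun n : ℕ => Real.exp (-(n * κ))) Filter.atTop (nhds 0) :=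
      Real.tendsto_exp_neg_atTop_nhds_zero.comp
        (tendsto_natCast_atTop_atTop.atTop_mul_const hκ)
    exact h1.eventually (ge_mem_nhds (by norm_num))
  obtain ⟨N, hN⟩ := hR (1 / 2) (by norm_num)
  obtain ⟨n, hn, hn1, hn2⟩ := ((Filter.eventually_ge_atTop N).and
    ((hexp (2 * δ) (by positivity)).and (hexp (l * δ / 2) (by positivity)))).exists
  obtain ⟨M, L, code, hM, -, herr⟩ := hN n hn
  have hM0 : (0 : ℝ) < M := lt_of_lt_of_le (by positivity) hM
  have herr' := herr (fun s => ∏ i, q (s i)) (isPMF_pi fun _ => hq)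
  have hVP : ∀ y : Fin n → Y, IsPMF fun z : Fin n → Z => ∏ i, V (y i) (z i) :=
    fun y => isPMF_pi fun i => hV (y i)
  have hUP : ∀ m, IsPMF fun y : Fin n → Y => ∏ i, U (code.f m i) (y i) :=
    fun m => isPMF_pi fun i => hU _
  have h1 : code.errJoint W (fun s => ∏ i, q (s i)) = (M : ℝ)⁻¹ * ∑ m, ∑ y, ∑ z,
      if code.g (y, code.f1 z) = m then 0
        else (∏ i, U (code.f m i) (y i)) * ∏ i, V (y i) (z i) := by
    have h2 : ∀ m (y : Fin n → Y) (z : Fin n → Z),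
        (∏ i, U (code.f m i) (y i)) * ∏ i, V (y i) (z i)
        = ∑ s : Fin n → S, (∏ i, q (s i)) * ∏ i, W (code.f m i) (s i) (y i, z i) := by
      intro m y z
      simp_rw [← Finset.prod_mul_distrib]
      rw [sum_prod_apply fun i s => q s * W (code.f m i) s (y i, z i)]
      refine Finset.prod_congr rfl fun i _ => ?_
      rw [hUdef, avgCh, Finset.sum_mul]
      refine Finset.sum_congr rfl fun s _ => ?_
      rw [hW, mul_assoc]
    unfold PCode.errJoint PCode.errGiven
    simp_rw [mul_left_comm _ (M : ℝ)⁻¹, ← Finset.mul_sum, h2]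
    congr 1
    simp_rw [Finset.mul_sum]
    rw [Finset.sum_comm]
    refine Finset.sum_congr rfl fun m _ => ?_
    rw [Finset.sum_comm]
    refine Finset.sum_congr rfl fun y _ => ?_
    rw [Finset.sum_comm]
    refine Finset.sum_congr rfl fun z _ => ?_
    split_ifs <;> simp
  have h2 : (∑ m, ∑ y, ∑ z, if code.g (y, code.f1 z) = m then 0
        else (∏ i, U (code.f m i) (y i)) * ∏ i, V (y i) (z i))
      + ∑ m, ∑ y, ∑ z, (if code.g (y, code.f1 z) = m then
        (∏ i, U (code.f m i) (y i)) * ∏ i, V (y i) (z i) else 0) = M := by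
    simp_rw [← Finset.sum_add_distrib]
    calc _ = ∑ m : Fin M, ∑ y : Fin n → Y, ∑ z : Fin n → Z,
          (∏ i, U (code.f m i) (y i)) * ∏ i, V (y i) (z i) := by
          refine Finset.sum_congr rfl fun m _ => Finset.sum_congr rfl fun y _ =>
            Finset.sum_congr rfl fun z _ => ?_
          split_ifs <;> simp
      _ = M := by
          simp_rw [← Finset.mul_sum, (hVP _).2, mul_one, (hUP _).2]
          simp
  have h3 := sum_correct_le hU hV hQ hQU hl0.le hB hlB hD code.f
    (fun y z => code.g (y, code.f1 z)) (a := C + 2 * δ)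
  rw [Fintype.card_fin, Fintype.card_fin] at h3
  rw [h1, inv_mul_le_iff₀ hM0] at herr'
  have h4 : Real.exp (n * (C + 2 * δ)) ≤ M * (1 / 8) := by
    calc _ = Real.exp (n * (R * Real.log 2)) * Real.exp (-(n * (2 * δ))) := by
          rw [← Real.exp_add]
          congr 1
          rw [hδ]
          ring
      _ ≤ M * (1 / 8) := by
          refine mul_le_mul ?_ hn1 (Real.exp_pos _).le hM0.le
          refine le_trans (le_of_eq ?_) hM
          rw [Real.rpow_def_of_pos two_pos]
          ring_nf
  have h5 : Real.exp (n * (l ^ 2 * B ^ 2 - l * (C + 2 * δ - (C + δ)))) ≤ 1 / 8 := by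
    refine (Real.exp_le_exp.2 ?_).trans hn2
    rw [← mul_neg]
    refine mul_le_mul_of_nonneg_left ?_ (Nat.cast_nonneg n)
    nlinarith [mul_le_mul_of_nonneg_left hlB2 hl0.le]
  have h6 := mul_le_mul_of_nonneg_left h5 hM0.le
  linarith

end Converse

section Concatenation

variable {X S Y Z : Type} [Fintype Y]

/-- Error of the code which first sends `k` by `c₁` and then `m` by the codebook `c₂ k`. -/
theorem blockErr_concat_le {V : X → S → Y → ℝ} (hV : IsChannel V) {κ ν ι₁ ι₂ : Type}
    [Fintype κ] [DecidableEq κ] [Fintype ν] [DecidableEq ν] [Nonempty ν] [Fintype ι₁]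
    [DecidableEq ι₁] [Fintype ι₂] [DecidableEq ι₂]
    (c₁ : κ → ι₁ → X) (d₁ : (ι₁ → Y) → κ) (c₂ : κ → ν → ι₂ → X) (d₂ : κ → (ι₂ → Y) → ν)
    (s : ι₁ ⊕ ι₂ → S) :
    blockErr V (fun m : κ × ν => Sum.elim (c₁ m.1) (c₂ m.1 m.2))
        (fun y => (d₁ (y ∘ Sum.inl), d₂ (d₁ (y ∘ Sum.inl)) (y ∘ Sum.inr))) s
      ≤ blockErr V c₁ d₁ (s ∘ Sum.inl)
        + (Fintype.card κ : ℝ)⁻¹ * ∑ k, blockErr V (c₂ k) (d₂ k) (s ∘ Sum.inr) := by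
  set P₁ : κ → (ι₁ → Y) → ℝ := fun k y => ∏ i, V (c₁ k i) (s (Sum.inl i)) (y i) with hP₁
  set P₂ : κ → ν → (ι₂ → Y) → ℝ := fun k m y => ∏ i, V (c₂ k m i) (s (Sum.inr i)) (y i) with hP₂
  have h₁ : ∀ k, IsPMF (P₁ k) := fun k => isPMF_pi fun i => hV (c₁ k i) (s (Sum.inl i))
  have h₂ : ∀ k m, IsPMF (P₂ k m) := fun k m => isPMF_pi fun i => hV (c₂ k m i) (s (Sum.inr i))
  have hkey : ∀ k m, (∑ y : ι₁ ⊕ ι₂ → Y,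
      if (d₁ (y ∘ Sum.inl), d₂ (d₁ (y ∘ Sum.inl)) (y ∘ Sum.inr)) = (k, m) then 0
        else ∏ i, V (Sum.elim (c₁ k) (c₂ k m) i) (s i) (y i))
      ≤ (∑ y, if d₁ y = k then 0 else P₁ k y) + ∑ y, if d₂ k y = m then 0 else P₂ k m y := by
    intro k m
    rw [← (Equiv.sumArrowEquivProdArrow ι₁ ι₂ Y).symm.sum_comp, Fintype.sum_prod_type]
    calc _ ≤ ∑ y₁, ∑ y₂, ((if d₁ y₁ = k then 0 else P₁ k y₁) * P₂ k m y₂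
          + P₁ k y₁ * if d₂ k y₂ = m then 0 else P₂ k m y₂) := by
          refine Finset.sum_le_sum fun y₁ _ => Finset.sum_le_sum fun y₂ _ => ?_
          have h3 : (Equiv.sumArrowEquivProdArrow ι₁ ι₂ Y).symm (y₁, y₂) ∘ Sum.inl = y₁ := rfl
          have h4 : (Equiv.sumArrowEquivProdArrow ι₁ ι₂ Y).symm (y₁, y₂) ∘ Sum.inr = y₂ := rfl
          have h5 : (∏ i, V (Sum.elim (c₁ k) (c₂ k m) i) (s i)
              ((Equiv.sumArrowEquivProdArrow ι₁ ι₂ Y).symm (y₁, y₂) i))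
              = P₁ k y₁ * P₂ k m y₂ := by
            rw [Fintype.prod_sum_type]
            rfl
          rw [h3, h4, h5]
          have h6 := (h₁ k).1 y₁
          have h7 := (h₂ k m).1 y₂
          by_cases h8 : d₁ y₁ = k
          · by_cases h9 : d₂ k y₂ = m <;> simp [h8, h9]
          · have h10 : (d₁ y₁, d₂ (d₁ y₁) y₂) ≠ (k, m) := fun h => h8 (Prod.ext_iff.1 h).1
            rw [if_neg h10, if_neg h8]
            refine le_add_of_nonneg_right (mul_nonneg h6 ?_)
            split_ifs
            · exact le_rfl
            · exact h7
      _ = _ := by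
          simp_rw [Finset.sum_add_distrib, ← Finset.mul_sum, (h₂ k m).2, mul_one]
          rw [← Finset.sum_mul, (h₁ k).2, one_mul]
  have hν : (Fintype.card ν : ℝ) ≠ 0 := by simp
  unfold blockErr
  rw [Fintype.sum_prod_type, Fintype.card_prod, Nat.cast_mul]
  calc _ ≤ ((Fintype.card κ : ℝ) * Fintype.card ν)⁻¹ * ∑ k, ∑ m,
        ((∑ y, if d₁ y = k then 0 else P₁ k y) + ∑ y, if d₂ k y = m then 0 else P₂ k m y) := by
        gcongr with k _ m _
        exact hkey k m
    _ = _ := by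
        simp_rw [Finset.sum_add_distrib, Finset.sum_const, nsmul_eq_mul, Finset.card_univ]
        rw [← Finset.mul_sum, mul_add, ← Finset.mul_sum, mul_inv]
        congr 1
        · field_simp
          rfl
        · rw [mul_assoc]
          rfl

/-- The relay code that ignores the relay and uses a block code for the direct channel. -/
def relayFreeCode {ι μ : Type} {n M : ℕ} (eι : Fin n ≃ ι) (eμ : Fin M ≃ μ) (c : μ → ι → X)
    (d : (ι → Y) → μ) : PCode X Y Z n M 1 where
  f m i := c (eμ m) (eι i)
  f1 _ := 0
  g y := eμ.symm (d (y.1 ∘ eι.symm))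

theorem relayFreeCode_errGiven [Fintype Z] {W : X → S → Y × Z → ℝ} {WY : X → S → Y → ℝ}
    {V : Y → Z → ℝ} (hV : ∀ y, IsPMF (V y)) (hW : ∀ x s y z, W x s (y, z) = WY x s y * V y z)
    {ι μ : Type} [Fintype ι] [DecidableEq ι] [Fintype μ] [DecidableEq μ] {n M : ℕ}
    (eι : Fin n ≃ ι) (eμ : Fin M ≃ μ) (c : μ → ι → X) (d : (ι → Y) → μ) (s : Fin n → S) :
    (relayFreeCode eι eμ c d : PCode X Y Z n M 1).errGiven W s
      = blockErr WY c d (s ∘ eι.symm) := by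
  have hVP : ∀ y : Fin n → Y, IsPMF fun z : Fin n → Z => ∏ i, V (y i) (z i) :=
    fun y => isPMF_pi fun i => hV (y i)
  unfold PCode.errGiven blockErr relayFreeCode
  rw [← Fintype.card_congr eμ, Fintype.card_fin, ← eμ.sum_comp]
  congr 1
  refine Finset.sum_congr rfl fun m _ => ?_
  rw [← (Equiv.arrowCongr eι (Equiv.refl Y)).sum_comp]
  refine Finset.sum_congr rfl fun y _ => ?_
  have h1 : (Equiv.arrowCongr eι (Equiv.refl Y)) y = y ∘ eι.symm := rfl
  simp only [h1, Equiv.symm_apply_eq]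
  split_ifs
  · simp
  · simp_rw [hW, Finset.prod_mul_distrib]
    rw [← Finset.mul_sum, (hVP y).2, mul_one, ← eι.prod_comp]
    simp

theorem errJoint_le [Fintype S] [Fintype Z] {n M L : ℕ} {W : X → S → Y × Z → ℝ}
    {C : PCode X Y Z n M L} {ε : ℝ} (h : ∀ s, C.errGiven W s ≤ ε) {qn : (Fin n → S) → ℝ}
    (hq : IsPMF qn) : C.errJoint W qn ≤ ε := by
  calc C.errJoint W qn ≤ ∑ s, qn s * ε :=
        Finset.sum_le_sum fun s _ => mul_le_mul_of_nonneg_left (h s) (hq.1 s)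
    _ = ε := by rw [← Finset.sum_mul, hq.2, one_mul]

theorem linkOK_one (n : ℕ) {C1 : ℝ} (hC1 : 0 ≤ C1) : LinkOK n 1 C1 :=
  ⟨le_rfl, by
    rw [Nat.cast_one]
    exact Real.one_le_rpow one_le_two (by positivity)⟩

theorem achievable_of_nonpos [Fintype S] [Fintype Z] [Nonempty X] (W : X → S → Y × Z → ℝ)
    {C1 R : ℝ} (hC1 : 0 ≤ C1) (hR : R ≤ 0) : AVRCAchievable W C1 R := by
  obtain ⟨x₀⟩ := ‹Nonempty X›
  refine fun ε hε => ⟨0, fun n _ => ⟨1, 1, ⟨fun _ _ => x₀, fun _ => 0, fun _ => 0⟩, ?_,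
    linkOK_one n hC1, fun qn hq => errJoint_le (fun s => ?_) hq⟩⟩
  · rw [Nat.cast_one]
    exact Real.rpow_le_one_of_one_le_of_nonpos one_le_two
      (mul_nonpos_of_nonneg_of_nonpos (Nat.cast_nonneg n) hR)
  · refine le_of_eq_of_le ?_ hε.le
    unfold PCode.errGiven
    simp

theorem achievable_of_isEmpty [Fintype S] [Fintype Z] [Nonempty X] [IsEmpty S]
    (W : X → S → Y × Z → ℝ) {C1 : ℝ} (hC1 : 0 ≤ C1) (R : ℝ) : AVRCAchievable W C1 R := by
  obtain ⟨x₀⟩ := ‹Nonempty X›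
  refine fun ε hε => ⟨1, fun n hn => ?_⟩
  have : Nonempty (Fin n) := ⟨⟨0, hn⟩⟩
  have hM : 0 < ⌈(2 : ℝ) ^ ((n : ℝ) * R)⌉₊ := Nat.ceil_pos.2 (by positivity)
  exact ⟨_, 1, ⟨fun _ _ => x₀, fun _ => 0, fun _ => ⟨0, hM⟩⟩, Nat.le_ceil _, linkOK_one n hC1,
    fun qn hq => errJoint_le (fun s => isEmptyElim s) hq⟩

/-- Rates below the max-min mutual information are achievable. -/
theorem achievable_of_lt [Fintype X] [Fintype S] [Fintype Z] [Nonempty X] [Nonempty S]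
    {W : X → S → Y × Z → ℝ} {WY : X → S → Y → ℝ} (hWY : IsChannel WY)
    (hns : ¬ Symmetrizable WY) {V : Y → Z → ℝ} (hV : ∀ y, IsPMF (V y))
    (hW : ∀ x s y z, W x s (y, z) = WY x s y * V y z) {C1 R R₀ : ℝ} (hC1 : 0 ≤ C1)
    (hR₀ : 0 < R₀) (hRR₀ : R * Real.log 2 < R₀)
    (hMI : ∀ q, IsPMF q → ∃ p, IsPMF p ∧ R₀ ≤ natMI p (avgCh WY q)) : AVRCAchievable W C1 R := by
  classical
  intro ε hε
  set σ := max (R * Real.log 2) 0 with hσ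
  obtain ⟨ρ, hσρ, hρR⟩ := exists_between (max_lt hRR₀ hR₀)
  rw [← hσ] at hσρ
  obtain ⟨K₀, hK₀⟩ := exists_prefix_code hWY hns (half_pos hε)
  obtain ⟨K₁, hK₁⟩ := exists_correlated_code hWY hR₀ hρR (half_pos hε) hMI
  set K := max 1 (max K₀ K₁) with hK
  have hK1 : 1 ≤ K := le_max_left _ _
  obtain ⟨d₁, hd₁⟩ := hK₀ K ((le_max_left _ _).trans (le_max_right _ _))
  obtain ⟨N, hN⟩ := hK₁ K ((le_max_right _ _).trans (le_max_right _ _))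
  set l := Fintype.card (Fin K → X) with hl
  obtain ⟨N', hN'⟩ := exists_nat_ge ((Real.log 2 + l * ρ) / (ρ - σ))
  refine ⟨max N' (N + l), fun n hn => ?_⟩
  obtain ⟨n', rfl⟩ : ∃ n', n = l + n' :=
    Nat.exists_eq_add_of_le ((Nat.le_add_left l N).trans ((le_max_right _ _).trans hn))
  have hn' : N ≤ n' := by
    have := (le_max_right N' (N + l)).trans hn
    lia
  set A : ℝ := (2 : ℝ) ^ (((l + n' : ℕ) : ℝ) * R) with hA
  have hA0 : 0 < A := by positivity
  set M := ⌈A⌉₊ with hM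
  have hM1 : 1 ≤ M := Nat.ceil_pos.2 hA0
  have hMρ : (M : ℝ) ≤ Real.exp (n' * ρ) := by
    have hAσ : A ≤ Real.exp (((l + n' : ℕ) : ℝ) * σ) := by
      rw [hA, Real.rpow_def_of_pos two_pos, Real.exp_le_exp]
      have := mul_le_mul_of_nonneg_left (le_max_left (R * Real.log 2) 0)
        (Nat.cast_nonneg (α := ℝ) (l + n'))
      rw [← hσ] at this
      linarith
    have h1 : 1 ≤ Real.exp (((l + n' : ℕ) : ℝ) * σ) :=
      Real.one_le_exp (mul_nonneg (Nat.cast_nonneg _) (le_max_right _ _))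
    have h2 : (Real.log 2 + l * ρ) / (ρ - σ) ≤ ((l + n' : ℕ) : ℝ) :=
      hN'.trans (by exact_mod_cast (le_max_left _ _).trans hn)
    rw [div_le_iff₀ (by linarith)] at h2
    calc (M : ℝ) ≤ A + 1 := (Nat.ceil_lt_add_one hA0.le).le
      _ ≤ 2 * Real.exp (((l + n' : ℕ) : ℝ) * σ) := by linarith
      _ = Real.exp (Real.log 2 + ((l + n' : ℕ) : ℝ) * σ) := by
          rw [Real.exp_add, Real.exp_log two_pos]
      _ ≤ Real.exp (n' * ρ) := by
          rw [Real.exp_le_exp]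
          push_cast at h2 ⊢
          linarith
  obtain ⟨cc, dd, hcd⟩ := hN n' hn' M hM1 hMρ
  have : Nonempty (Fin M) := ⟨⟨0, hM1⟩⟩
  have eι : Fin (l + n') ≃ (Fin K → X) ⊕ Fin n' := Fintype.equivOfCardEq (by simp [hl])
  refine ⟨K * M, 1, relayFreeCode eι finProdFinEquiv.symm
    (fun m : Fin K × Fin M => Sum.elim (fun t => t m.1) (cc m.1 m.2))
    (fun y => (d₁ (y ∘ Sum.inl), dd (d₁ (y ∘ Sum.inl)) (y ∘ Sum.inr))), ?_, linkOK_one _ hC1,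
    fun qn hq => errJoint_le (fun s => ?_) hq⟩
  · refine (Nat.le_ceil A).trans ?_
    exact_mod_cast Nat.le_mul_of_pos_left M hK1
  · rw [relayFreeCode_errGiven hV hW]
    refine (blockErr_concat_le hWY (fun i (t : Fin K → X) => t i) d₁ cc dd _).trans ?_
    have h1 := hd₁ ((s ∘ eι.symm) ∘ Sum.inl)
    have h2 := hcd ((s ∘ eι.symm) ∘ Sum.inr)
    rw [Fintype.card_fin]
    linarith

end Concatenation

theorem not_symmetrizable_of_degraded {X S Y Z : Type} [Fintype S] [Fintype Y]
    {W : X → S → Y × Z → ℝ} {WY : X → S → Y → ℝ} {V : Y → Z → ℝ}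
    (hW : ∀ x s y z, W x s (y, z) = WY x s y * V y z)
    (h : ¬ Symmetrizable fun x s z => ∑ y, W x s (y, z)) : ¬ Symmetrizable WY := by
  rintro ⟨J, hJ, hs⟩
  refine h ⟨J, hJ, fun x x' z => ?_⟩
  have h1 : ∀ x x', ∑ s, (∑ y, W x s (y, z)) * J x' s = ∑ y, V y z * ∑ s, WY x s y * J x' s := by
    intro x x'
    simp_rw [hW, Finset.sum_mul, Finset.mul_sum]
    rw [Finset.sum_comm]
    exact Finset.sum_congr rfl fun y _ => Finset.sum_congr rfl fun s _ => by ring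
  simp only [h1, hs x x']

theorem mutInfo_eq_natMI_div {X Y : Type} [Fintype X] [Fintype Y] (p : X → ℝ) {U : X → Y → ℝ}
    (hU : ∀ x, IsPMF (U x)) :
    mutInfo (fun a : X × Y => p a.1 * U a.1 a.2) = natMI p U / Real.log 2 := by
  have h1 : ∀ a b : ℝ, a * b * Real.log (a * b) = b * (a * Real.log a) + a * (b * Real.log b) := by
    intro a b
    rcases eq_or_ne a 0 with rfl | ha
    · simp
    rcases eq_or_ne b 0 with rfl | hb
    · simp
    rw [Real.log_mul ha hb]
    ring
  unfold mutInfo ent natMI outDist Real.logb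
  simp_rw [Fintype.sum_prod_type, ← Finset.mul_sum, (hU _).2, mul_one, mul_div_assoc',
    ← Finset.sum_div, h1, Finset.sum_add_distrib, ← Finset.sum_mul, (hU _).2, ← Finset.mul_sum]
  ring

theorem IqXY_eq {X S Y Z : Type} [Fintype X] [Fintype S] [Fintype Y] [Fintype Z]
    {W : X → S → Y × Z → ℝ} {WY : X → S → Y → ℝ} (hWY : IsChannel WY) {V : Y → Z → ℝ}
    (hV : ∀ y, IsPMF (V y)) (hW : ∀ x s y z, W x s (y, z) = WY x s y * V y z) (p : X → ℝ)
    {q : S → ℝ} (hq : IsPMF q) : IqXY W p q = natMI p (avgCh WY q) / Real.log 2 := by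
  rw [← mutInfo_eq_natMI_div p (avgCh_isPMF hWY hq)]
  unfold IqXY avgCh
  simp_rw [hW, ← Finset.mul_sum, (hV _).2, mul_one]

theorem natMI_single {X Y : Type} [Fintype X] [DecidableEq X] [Fintype Y] (x₀ : X)
    (U : X → Y → ℝ) : natMI (fun x => if x = x₀ then 1 else 0) U = 0 := by
  simp [natMI, outDist]

/-- The capacity of the channel `U`, in nats, is attained. -/
theorem exists_isGreatest_natMI {X Y : Type} [Fintype X] [Nonempty X] [Fintype Y]
    (U : X → Y → ℝ) : ∃ p, IsPMF p ∧ 0 ≤ natMI p U ∧ ∀ p', IsPMF p' → natMI p' U ≤ natMI p U := by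
  classical
  obtain ⟨x₀⟩ := ‹Nonempty X›
  have h0 : IsPMF fun x => if x = x₀ then (1 : ℝ) else 0 :=
    ⟨fun x => by positivity, by simp⟩
  obtain ⟨p, hp, hmax⟩ := (isCompact_stdSimplex ℝ X).exists_isMaxOn ⟨_, h0⟩
    (continuous_natMI_left U).continuousOn
  refine ⟨p, hp, ?_, fun p' hp' => hmax hp'⟩
  have : natMI _ U ≤ natMI p U := hmax h0
  rwa [natMI_single] at this

/-- For a reversely strongly degraded primitive AVRC whose marginal sender-to-relay
channel `W_{Y₁|X,S}` is non-symmetrizable, with `C₁ > 0`, the deterministic code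
capacity equals `min_{q(s)} max_{p(x)} I_q(X;Y)`. -/
theorem avrc_revStronglyDegraded_detCapacity
    {𝒳 𝒮 𝒴 𝒴₁ : Type} [Fintype 𝒳] [Fintype 𝒮] [Fintype 𝒴] [Fintype 𝒴₁] [Nonempty 𝒳]
    (W : 𝒳 → 𝒮 → 𝒴 × 𝒴₁ → ℝ) (hW : IsChannel W)
    (C1 : ℝ) (hC1 : 0 < C1)
    (hdeg : RevStronglyDegraded W)
    (hnonsym : ¬ Symmetrizable (fun x s y1 => ∑ y, W x s (y, y1))) :
    AVRCCapacity W C1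
      = sInf {r | ∃ q : 𝒮 → ℝ, IsPMF q ∧
          r = sSup {v | ∃ p : 𝒳 → ℝ, IsPMF p ∧ v = IqXY W p q}} := by
  obtain ⟨WY, V, hWY, hV, hWV⟩ := hdeg
  have hns : ¬ Symmetrizable WY := not_symmetrizable_of_degraded hWV hnonsym
  have hlog : 0 < Real.log 2 := Real.log_pos one_lt_two
  unfold AVRCCapacity
  rcases isEmpty_or_nonempty 𝒮 with hS | hS
  · have h1 : {R | AVRCAchievable W C1 R} = Set.univ :=
      Set.eq_univ_of_forall fun R => achievable_of_isEmpty W hC1.le R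
    have h2 : {r | ∃ q : 𝒮 → ℝ, IsPMF q ∧
        r = sSup {v | ∃ p : 𝒳 → ℝ, IsPMF p ∧ v = IqXY W p q}} = ∅ := by
      refine Set.eq_empty_of_forall_notMem fun r hr => ?_
      obtain ⟨q, hq, -⟩ := hr
      simpa using hq.2
    rw [h1, h2, Real.sSup_univ, Real.sInf_empty]
  choose! pm hpm hpm0 hpmax using fun q : 𝒮 → ℝ => exists_isGreatest_natMI (avgCh WY q)
  have hmax : ∀ q : 𝒮 → ℝ, IsPMF q → sSup {v | ∃ p : 𝒳 → ℝ, IsPMF p ∧ v = IqXY W p q}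
      = natMI (pm q) (avgCh WY q) / Real.log 2 := by
    intro q hq
    refine IsGreatest.csSup_eq ⟨⟨pm q, hpm q, (IqXY_eq hWY hV hWV _ hq).symm⟩, ?_⟩
    rintro v ⟨p, hp, rfl⟩
    rw [IqXY_eq hWY hV hWV p hq]
    exact div_le_div_of_nonneg_right (hpmax q p hp) hlog.le
  set A := {r | ∃ q : 𝒮 → ℝ, IsPMF q ∧
    r = sSup {v | ∃ p : 𝒳 → ℝ, IsPMF p ∧ v = IqXY W p q}} with hA
  have hAne : A.Nonempty := by
    classical
    obtain ⟨s₀⟩ := hS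
    exact ⟨_, fun s => if s = s₀ then 1 else 0, ⟨fun s => by positivity, by simp⟩, rfl⟩
  have hAbdd : BddBelow A := by
    refine ⟨0, ?_⟩
    rintro r ⟨q, hq, rfl⟩
    rw [hmax q hq]
    exact div_nonneg (hpm0 q) hlog.le
  refine csSup_eq_of_forall_le_of_forall_lt_exists_gt
    ⟨0, achievable_of_nonpos W hC1.le le_rfl⟩ (fun R hR => ?_) fun R hR => ?_
  · refine le_csInf hAne ?_
    rintro r ⟨q, hq, rfl⟩
    rw [hmax q hq, le_div_iff₀ hlog]
    exact achievable_le hWY hV hWV hR hq (hpm0 q) (hpmax q)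
  · obtain ⟨R', hRR', hR'⟩ := exists_between hR
    refine ⟨R', ?_, hRR'⟩
    rcases le_or_gt R' 0 with h0 | h0
    · exact achievable_of_nonpos W hC1.le h0
    refine achievable_of_lt hWY hns hV hWV hC1.le (mul_pos (h0.trans hR') hlog)
      (mul_lt_mul_of_pos_right hR' hlog) fun q hq => ⟨pm q, hpm q, ?_⟩
    rw [← le_div_iff₀ hlog, ← hmax q hq]
    exact csInf_le hAbdd ⟨q, hq, rfl⟩
end
end

section
/- For a primitive AVRC: if the channel W_{Ỹ|X,S} with combined output Ỹ = (Y, Y_1) is symmetrizable, then the deterministic code capacity of the primitive AVRC is zero. -/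
open scoped BigOperators ENNReal

noncomputable section

/-- A product of finite sums over a fixed finite type is a sum over functions. -/
theorem sum_pi_prod_eq_prod_sum {α : Type} [Fintype α] {n : ℕ} (F : Fin n → α → ℝ) :
    ∑ x : Fin n → α, ∏ i, F i (x i) = ∏ i, ∑ a, F i a := by
  rw [Finset.prod_univ_sum, Fintype.piFinset_univ]

/-- A product of pmfs is a pmf. -/
theorem IsPMF.pi {α : Type} [Fintype α] {n : ℕ} {p : Fin n → α → ℝ}
    (hp : ∀ i, IsPMF (p i)) : IsPMF (fun x : Fin n → α => ∏ i, p i (x i)) := by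
  refine ⟨fun x => Finset.prod_nonneg fun i _ => (hp i).1 _, ?_⟩
  rw [sum_pi_prod_eq_prod_sum]
  exact Finset.prod_eq_one fun i _ => (hp i).2

/-- Averaging a channel over a randomized state choice gives a pmf. -/
theorem IsChannel.isPMF_average {𝒳 𝒮 𝒵 : Type} [Fintype 𝒮] [Fintype 𝒵]
    {W : 𝒳 → 𝒮 → 𝒵 → ℝ} (hW : IsChannel W) (x : 𝒳) {q : 𝒮 → ℝ} (hq : IsPMF q) :
    IsPMF (fun z => ∑ s, W x s z * q s) := by
  refine ⟨fun z => Finset.sum_nonneg fun s _ => mul_nonneg ((hW x s).1 z) (hq.1 s), ?_⟩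
  rw [Finset.sum_comm]
  simp_rw [← Finset.sum_mul, (hW x _).2, one_mul]
  exact hq.2

/-- The joint law of two blocks with independent pairs of entries has total mass one. -/
theorem sum_sum_prod_eq_one {β γ : Type} [Fintype β] [Fintype γ] {n : ℕ}
    {p : Fin n → β × γ → ℝ} (hp : ∀ i, IsPMF (p i)) :
    ∑ y : Fin n → β, ∑ y1 : Fin n → γ, ∏ i, p i (y i, y1 i) = 1 := by
  have inner (y : Fin n → β) : ∑ y1 : Fin n → γ, ∏ i, p i (y i, y1 i) =
      ∏ i, ∑ c, p i (y i, c) := sum_pi_prod_eq_prod_sum fun i c => p i (y i, c)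
  simp_rw [inner]
  rw [sum_pi_prod_eq_prod_sum fun i b => ∑ c, p i (b, c)]
  refine Finset.prod_eq_one fun i _ => ?_
  rw [← Fintype.sum_prod_type']
  exact (hp i).2

/-- Under a product state distribution, the error probability is that of the averaged channel. -/
theorem PCode.errJoint_prod {𝒳 𝒮 𝒴 𝒴₁ : Type} [Fintype 𝒮] [Fintype 𝒴] [Fintype 𝒴₁]
    {n M L : ℕ} (C : PCode 𝒳 𝒴 𝒴₁ n M L) (W : 𝒳 → 𝒮 → 𝒴 × 𝒴₁ → ℝ) (q : Fin n → 𝒮 → ℝ) :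
    C.errJoint W (fun s => ∏ i, q i (s i)) =
      (M : ℝ)⁻¹ * ∑ m : Fin M, ∑ y : Fin n → 𝒴, ∑ y1 : Fin n → 𝒴₁,
        if C.g (y, C.f1 y1) = m then 0
        else ∏ i, ∑ s, W (C.f m i) s (y i, y1 i) * q i s := by
  unfold PCode.errJoint PCode.errGiven
  simp_rw [mul_left_comm _ ((M : ℝ)⁻¹), ← Finset.mul_sum]
  congr 1
  simp_rw [Finset.mul_sum]
  rw [Finset.sum_comm]
  refine Finset.sum_congr rfl fun m _ => ?_
  rw [Finset.sum_comm]
  refine Finset.sum_congr rfl fun y _ => ?_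
  rw [Finset.sum_comm]
  refine Finset.sum_congr rfl fun y1 _ => ?_
  split_ifs
  · simp
  · rw [← sum_pi_prod_eq_prod_sum fun i s => W (C.f m i) s (y i, y1 i) * q i s]
    refine Finset.sum_congr rfl fun s _ => ?_
    rw [Finset.prod_mul_distrib, mul_comm]

/-- If off-diagonal pairs of a nonnegative matrix satisfy `1 ≤ e a b + e b a`, then the sum of its
entries is at least half the number of off-diagonal entries. -/
theorem card_mul_card_sub_one_le_two_mul_sum {M : ℕ} {e : Fin M → Fin M → ℝ}
    (he : ∀ a b, 0 ≤ e a b) (hpair : ∀ a b, a ≠ b → 1 ≤ e a b + e b a) :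
    (M : ℝ) * (M - 1) ≤ 2 * ∑ a, ∑ b, e a b := by
  have hsum : ∑ a : Fin M, ∑ b : Fin M, ((1 : ℝ) - if a = b then 1 else 0) ≤
      ∑ a, ∑ b, (e a b + e b a) := by
    refine Finset.sum_le_sum fun a _ => Finset.sum_le_sum fun b _ => ?_
    split_ifs with h
    · linarith [he a b, he b a]
    · linarith [hpair a b h]
  have hleft : ∑ a : Fin M, ∑ b : Fin M, ((1 : ℝ) - if a = b then 1 else 0) =
      (M : ℝ) * (M - 1) := by
    simp [mul_sub]
  have hright : ∑ a, ∑ b, (e a b + e b a) = 2 * ∑ a, ∑ b, e a b := by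
    simp_rw [Finset.sum_add_distrib]
    rw [Finset.sum_comm (f := fun a b => e b a)]
    ring
  linarith

/-- A code for a symmetrizable primitive relay channel with at least two messages cannot have average
error probability below `1/4` under every state distribution. -/
theorem PCode.quarter_le_of_errJoint_le {𝒳 𝒮 𝒴 𝒴₁ : Type} [Fintype 𝒮] [Fintype 𝒴] [Fintype 𝒴₁]
    {n M L : ℕ} (C : PCode 𝒳 𝒴 𝒴₁ n M L) {W : 𝒳 → 𝒮 → 𝒴 × 𝒴₁ → ℝ} (hW : IsChannel W)
    (hsym : Symmetrizable W) (hM : 2 ≤ M) {ε : ℝ}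
    (herr : ∀ qn : (Fin n → 𝒮) → ℝ, IsPMF qn → C.errJoint W qn ≤ ε) : 1 / 4 ≤ ε := by
  obtain ⟨J, hJ, hWJ⟩ := hsym
  have hM' : (2 : ℝ) ≤ M := by exact_mod_cast hM
  let V (a b : Fin M) (y : Fin n → 𝒴) (y1 : Fin n → 𝒴₁) : ℝ :=
    ∏ i, ∑ s, W (C.f a i) s (y i, y1 i) * J (C.f b i) s
  let e (b a : Fin M) : ℝ := ∑ y : Fin n → 𝒴, ∑ y1 : Fin n → 𝒴₁,
    if C.g (y, C.f1 y1) = a then 0 else V a b y y1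
  have hVpmf (a b : Fin M) (i : Fin n) :
      IsPMF (fun z => ∑ s, W (C.f a i) s z * J (C.f b i) s) :=
    hW.isPMF_average (C.f a i) (hJ (C.f b i))
  have hV (a b y y1) : 0 ≤ V a b y y1 := Finset.prod_nonneg fun i _ => (hVpmf a b i).1 _
  have hVsymm (a b y y1) : V a b y y1 = V b a y y1 :=
    Finset.prod_congr rfl fun i _ => hWJ _ _ _
  have he (b a) : 0 ≤ e b a := by
    refine Finset.sum_nonneg fun y _ => Finset.sum_nonneg fun y1 _ => ?_
    split_ifs
    exacts [le_rfl, hV a b y y1]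
  have hpair (b a : Fin M) (hne : b ≠ a) : 1 ≤ e b a + e a b := by
    have htotal : ∑ y : Fin n → 𝒴, ∑ y1 : Fin n → 𝒴₁, V a b y y1 = 1 :=
      sum_sum_prod_eq_one
        (p := fun i z => ∑ s, W (C.f a i) s z * J (C.f b i) s) (hVpmf a b)
    simp only [← htotal, e, ← Finset.sum_add_distrib]
    refine Finset.sum_le_sum fun y _ => Finset.sum_le_sum fun y1 _ => ?_
    rw [hVsymm b a y y1]
    have := hV a b y y1
    split_ifs with h1 h2
    · exact absurd (h2.symm.trans h1) hne
    all_goals linarith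
  have hbound (b : Fin M) : ∑ a, e b a ≤ M * ε := by
    have h := herr _ (IsPMF.pi fun i => hJ (C.f b i))
    rw [C.errJoint_prod W fun i => J (C.f b i)] at h
    rwa [inv_mul_le_iff₀ (by linarith)] at h
  have hsum : ∑ b, ∑ a, e b a ≤ M * (M * ε) :=
    (Finset.sum_le_sum fun b _ => hbound b).trans_eq (by simp)
  have hcount := card_mul_card_sub_one_le_two_mul_sum he hpair
  have hle : (M : ℝ) * (M - 1) ≤ M * (2 * M * ε) := by linarith
  have hle' := le_of_mul_le_mul_left hle (by linarith)
  by_contra! hε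
  nlinarith

/-- Rate zero is achieved by a one-message code. -/
theorem avrcAchievable_zero {𝒳 𝒮 𝒴 𝒴₁ : Type} [Fintype 𝒮] [Fintype 𝒴] [Fintype 𝒴₁]
    [Nonempty 𝒳] (W : 𝒳 → 𝒮 → 𝒴 × 𝒴₁ → ℝ) {C1 : ℝ} (hC1 : 0 ≤ C1) :
    AVRCAchievable W C1 0 := by
  intro ε hε
  refine ⟨0, fun n _ => ⟨1, 1, ⟨fun _ _ => Classical.arbitrary 𝒳, fun _ => 0, fun _ => 0⟩,
    by simp, ⟨le_rfl, ?_⟩, fun qn _ => ?_⟩⟩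
  · rw [Nat.cast_one]
    exact Real.one_le_rpow one_le_two (by positivity)
  · simpa [PCode.errJoint, PCode.errGiven, Subsingleton.elim _ (0 : Fin 1)] using hε.le

/-- No positive rate is achievable over a symmetrizable primitive AVRC. -/
theorem AVRCAchievable.rate_nonpos {𝒳 𝒮 𝒴 𝒴₁ : Type} [Fintype 𝒮] [Fintype 𝒴] [Fintype 𝒴₁]
    {W : 𝒳 → 𝒮 → 𝒴 × 𝒴₁ → ℝ} (hW : IsChannel W) (hsym : Symmetrizable W) {C1 R : ℝ}
    (hR : AVRCAchievable W C1 R) : R ≤ 0 := by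
  by_contra! hpos
  obtain ⟨N, hN⟩ := hR (1 / 8) (by norm_num)
  obtain ⟨M, L, C, hM, -, herr⟩ := hN (N + 1) (Nat.le_succ N)
  have hM1 : (1 : ℝ) < M :=
    (Real.one_lt_rpow one_lt_two (by positivity)).trans_le hM
  have := C.quarter_le_of_errJoint_le hW hsym (by exact_mod_cast hM1) herr
  norm_num at this

/-- If the channel with combined output `Ỹ = (Y,Y₁)` is symmetrizable, then the
deterministic code capacity of the primitive AVRC is zero. -/
theorem avrc_symmetrizable_zero_capacity
    {𝒳 𝒮 𝒴 𝒴₁ : Type} [Fintype 𝒳] [Fintype 𝒮] [Fintype 𝒴] [Fintype 𝒴₁] [Nonempty 𝒳]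
    (W : 𝒳 → 𝒮 → 𝒴 × 𝒴₁ → ℝ) (hW : IsChannel W)
    (C1 : ℝ) (hC1 : 0 ≤ C1)
    (hsym : Symmetrizable W) :
    AVRCCapacity W C1 = 0 := by
  exact IsGreatest.csSup_eq ⟨avrcAchievable_zero W hC1, fun _ hR => hR.rate_nonpos hW hsym⟩
end
end
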